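/- arXiv:2205.05736 — 4 statements merged into one kernel-verified Lean document; each statement's English description precedes it below -/
import Mathlib

section
/- (Szegő-type theorem of Serra-Capizzano, restricted to nonnegative symbols.) Let a : [-π, π] → ℝ≥0 be a measurable nonnegative function such that ∫_{-π}^{π} a(φ)^α dφ/(2π) < ∞ for some α ≥ 1, and let F : ℝ≥0 → ℝ be continuous with F(x) = O(x^α) as x → ∞. For each d let T⁽ᵈ⁾ be the d × d (Hermitian, positive semidefinite) Toeplitz matrix with entries T⁽ᵈ⁾_{hk} = (1/2π) ∫_{-π}^{π} a(φ) e^{-i(h-k)φ} dφ, and let λ₁(T⁽ᵈ⁾), …, λ_d(T⁽ᵈ⁾) be its eigenvalues. Then lim_{d→∞} (1/d) Σ_{j=1}^{d} F(λ_j(T⁽ᵈ⁾)) = (1/2π) ∫_{-π}^{π} F(a(φ)) dφ. -/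
open scoped Real ComplexOrder
open MeasureTheory Filter

/-- Normalized Lebesgue measure on `(-π, π]`. -/
noncomputable def circleProb : Measure ℝ :=
  (ENNReal.ofReal (2 * π))⁻¹ • volume.restrict (Set.Ioc (-π) π)

lemma integral_circleProb {E : Type*} [NormedAddCommGroup E] [NormedSpace ℝ E] (f : ℝ → E) :
    ∫ φ, f φ ∂circleProb = (1 / (2 * π)) • ∫ φ in (-π)..π, f φ := by
  rw [circleProb, integral_smul_measure,
    intervalIntegral.integral_of_le (by linarith [Real.pi_pos]), ENNReal.toReal_inv,
    ENNReal.toReal_ofReal (by positivity), one_div]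

instance : IsProbabilityMeasure circleProb := by
  constructor
  have h : π - -π = 2 * π := by ring
  rw [circleProb, Measure.smul_apply, Measure.restrict_apply_univ, Real.volume_Ioc, h, smul_eq_mul,
    ENNReal.inv_mul_cancel (by simp [Real.pi_pos]) ENNReal.ofReal_ne_top]

lemma integrable_circleProb_iff {E : Type*} [NormedAddCommGroup E] {f : ℝ → E} :
    Integrable f circleProb ↔ IntegrableOn f (Set.Ioc (-π) π) := by
  rw [circleProb, integrable_smul_measure (by simp [ENNReal.mul_eq_top])
    (by simp [Real.pi_pos])]
  rfl

/-- The Toeplitz matrix of order `d` generated by the Fourier coefficients of `a`. -/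
noncomputable def toeplitz (a : ℝ → ℝ) (d : ℕ) : Matrix (Fin d) (Fin d) ℂ :=
  Matrix.of fun h k => ∫ φ, (a φ : ℂ) *
    Complex.exp (-Complex.I * (((h : ℕ) : ℂ) - ((k : ℕ) : ℂ)) * φ) ∂circleProb

lemma toeplitz_isHermitian (a : ℝ → ℝ) (d : ℕ) : (toeplitz a d).IsHermitian := by
  ext h k
  rw [Matrix.conjTranspose_apply, toeplitz, Matrix.of_apply, Matrix.of_apply, ← starRingEnd_apply,
    ← integral_conj]
  congr 1
  ext φ
  rw [map_mul, Complex.conj_ofReal, ← Complex.exp_conj]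
  congr 2
  simp only [map_mul, map_neg, Complex.conj_I, map_sub, Complex.conj_ofReal, map_natCast]
  ring

/-- The vector of the first `d` exponentials at `φ`. -/
noncomputable def expVec (d : ℕ) (φ : ℝ) : EuclideanSpace ℂ (Fin d) :=
  WithLp.toLp 2 fun k => Complex.exp (-Complex.I * ((k : ℕ) : ℂ) * φ)

/-- The squared modulus of the trigonometric polynomial with coefficient vector `v`. -/
noncomputable def spectralDensity {d : ℕ} (v : EuclideanSpace ℂ (Fin d)) (φ : ℝ) : ℝ :=
  ‖inner ℂ (expVec d φ) v‖ ^ 2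

lemma norm_expVec_sq (d : ℕ) (φ : ℝ) : ‖expVec d φ‖ ^ 2 = d := by
  rw [EuclideanSpace.norm_sq_eq]
  have : ∀ k : Fin d, ‖(expVec d φ) k‖ = 1 := by
    intro k
    simp [expVec, Complex.norm_exp]
  simp [this]

lemma continuous_spectralDensity {d : ℕ} (v : EuclideanSpace ℂ (Fin d)) :
    Continuous (spectralDensity v) := by
  unfold spectralDensity expVec
  fun_prop

lemma spectralDensity_nonneg {d : ℕ} (v : EuclideanSpace ℂ (Fin d)) (φ : ℝ) :
    0 ≤ spectralDensity v φ := sq_nonneg _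

lemma sum_spectralDensity {d : ℕ} (b : OrthonormalBasis (Fin d) ℂ (EuclideanSpace ℂ (Fin d)))
    (φ : ℝ) : ∑ i, spectralDensity (b i) φ = d := by
  simp only [spectralDensity]
  rw [b.sum_sq_norm_inner_left, norm_expVec_sq]

lemma spectralDensity_le {d : ℕ} (v : EuclideanSpace ℂ (Fin d)) (φ : ℝ) :
    spectralDensity v φ ≤ d * ‖v‖ ^ 2 := by
  rw [spectralDensity, ← norm_expVec_sq d φ, ← mul_pow]
  gcongr
  exact norm_inner_le_norm _ _

lemma integrable_mul_spectralDensity {μ : Measure ℝ} {f : ℝ → ℝ} (hf : Integrable f μ) {d : ℕ}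
    (v : EuclideanSpace ℂ (Fin d)) :
    Integrable (fun φ => f φ * spectralDensity v φ) μ := by
  refine hf.mul_bdd (c := d * ‖v‖ ^ 2) (continuous_spectralDensity v).aestronglyMeasurable ?_
  refine Eventually.of_forall fun φ => ?_
  rw [Real.norm_of_nonneg (spectralDensity_nonneg v φ)]
  exact spectralDensity_le v φ

lemma spectralDensity_eq_sum {d : ℕ} (v : EuclideanSpace ℂ (Fin d)) (φ : ℝ) :
    (spectralDensity v φ : ℂ) = ∑ h : Fin d, ∑ k : Fin d, star (v h) *
      Complex.exp (-Complex.I * (((h : ℕ) : ℂ) - ((k : ℕ) : ℂ)) * φ) * v k := by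
  rw [spectralDensity, Complex.ofReal_pow, ← Complex.conj_mul', inner_conj_symm]
  simp only [PiLp.inner_apply, RCLike.inner_apply, expVec]
  rw [Finset.sum_mul_sum]
  refine Finset.sum_congr rfl fun h _ => Finset.sum_congr rfl fun k _ => ?_
  rw [← Complex.exp_conj]
  simp only [map_mul, map_neg, Complex.conj_I, Complex.conj_ofReal, map_natCast]
  rw [starRingEnd_apply]
  have : Complex.exp (-Complex.I * (((h : ℕ) : ℂ) - ((k : ℕ) : ℂ)) * φ)
      = Complex.exp (-Complex.I * ((h : ℕ) : ℂ) * φ) *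
        Complex.exp (- -Complex.I * ((k : ℕ) : ℂ) * φ) := by
    rw [← Complex.exp_add]
    congr 1
    ring
  rw [this]
  ring

lemma integrable_mul_exp {μ : Measure ℝ} {f : ℝ → ℝ} (hf : Integrable f μ) (h k : ℕ) :
    Integrable (fun φ => (f φ : ℂ) *
      Complex.exp (-Complex.I * ((h : ℂ) - (k : ℂ)) * φ)) μ := by
  refine hf.ofReal.mul_bdd (c := 1) (by fun_prop) ?_
  refine Eventually.of_forall fun φ => ?_
  simp [Complex.norm_exp]

lemma dotProduct_toeplitz_mulVec {a : ℝ → ℝ} (ha : Integrable a circleProb) {d : ℕ}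
    (v : EuclideanSpace ℂ (Fin d)) :
    star v.ofLp ⬝ᵥ (toeplitz a d).mulVec v.ofLp
      = ((∫ φ, a φ * spectralDensity v φ ∂circleProb : ℝ) : ℂ) := by
  rw [← integral_complex_ofReal]
  have : ∀ φ, ((a φ * spectralDensity v φ : ℝ) : ℂ) = ∑ h : Fin d, ∑ k : Fin d, star (v h) *
      ((a φ : ℂ) * Complex.exp (-Complex.I * (((h : ℕ) : ℂ) - ((k : ℕ) : ℂ)) * φ)) * v k := by
    intro φ
    rw [Complex.ofReal_mul, spectralDensity_eq_sum, Finset.mul_sum]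
    refine Finset.sum_congr rfl fun h _ => ?_
    rw [Finset.mul_sum]
    refine Finset.sum_congr rfl fun k _ => ?_
    ring
  simp_rw [this]
  have hi : ∀ h k : Fin d, Integrable (fun φ : ℝ => star (v h) *
      ((a φ : ℂ) * Complex.exp (-Complex.I * (((h : ℕ) : ℂ) - ((k : ℕ) : ℂ)) * φ)) * v k)
      circleProb := fun h k => ((integrable_mul_exp ha h k).const_mul _).mul_const _
  rw [integral_finsetSum _ fun h _ => integrable_finsetSum _ fun k _ => hi h k]
  rw [dotProduct]
  refine Finset.sum_congr rfl fun h _ => ?_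
  rw [integral_finsetSum _ fun k _ => hi h k, Matrix.mulVec, dotProduct, Finset.mul_sum]
  refine Finset.sum_congr rfl fun k _ => ?_
  rw [integral_mul_const, integral_const_mul, toeplitz, Matrix.of_apply, Pi.star_apply, mul_assoc]

lemma eigenvalues_toeplitz {a : ℝ → ℝ} (ha : Integrable a circleProb) {d : ℕ} (i : Fin d) :
    (toeplitz_isHermitian a d).eigenvalues i
      = ∫ φ, a φ * spectralDensity ((toeplitz_isHermitian a d).eigenvectorBasis i) φ
        ∂circleProb := by
  rw [(toeplitz_isHermitian a d).eigenvalues_eq, dotProduct_toeplitz_mulVec ha]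
  simp

lemma toeplitz_one (d : ℕ) : toeplitz (fun _ => 1) d = 1 := by
  ext h k
  rw [toeplitz, Matrix.of_apply]
  by_cases hk : h = k
  · subst hk; simp
  · rw [Matrix.one_apply_ne hk, integral_circleProb]
    have hz : ((h : ℕ) : ℤ) - ((k : ℕ) : ℤ) ≠ 0 := by
      have := Fin.val_ne_of_ne hk
      omega
    have hc : -Complex.I * (((h : ℕ) : ℂ) - ((k : ℕ) : ℂ)) ≠ 0 := by
      refine mul_ne_zero (by simp) ?_
      exact_mod_cast hz
    simp only [Complex.ofReal_one, one_mul]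
    rw [integral_exp_mul_complex hc]
    have : Complex.exp (-Complex.I * (((h : ℕ) : ℂ) - ((k : ℕ) : ℂ)) * ((-π : ℝ) : ℂ))
        = Complex.exp (-Complex.I * (((h : ℕ) : ℂ) - ((k : ℕ) : ℂ)) * (π : ℂ)) := by
      rw [Complex.exp_eq_exp_iff_exists_int]
      refine ⟨(h : ℤ) - (k : ℤ), ?_⟩
      push_cast
      ring
    rw [this]
    simp

lemma integral_spectralDensity {d : ℕ} (v : EuclideanSpace ℂ (Fin d)) :
    ∫ φ, spectralDensity v φ ∂circleProb = ‖v‖ ^ 2 := by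
  have h := dotProduct_toeplitz_mulVec (integrable_const (1 : ℝ)) v
  rw [toeplitz_one, Matrix.one_mulVec] at h
  simp only [one_mul] at h
  rw [← Complex.ofReal_inj, ← h, dotProduct_comm, ← EuclideanSpace.inner_eq_star_dotProduct]
  simp [inner_self_eq_norm_sq_to_K]

lemma sum_integral_mul_spectralDensity {f : ℝ → ℝ} (hf : Integrable f circleProb) {d : ℕ}
    (b : OrthonormalBasis (Fin d) ℂ (EuclideanSpace ℂ (Fin d))) :
    ∑ i, ∫ φ, f φ * spectralDensity (b i) φ ∂circleProb = d * ∫ φ, f φ ∂circleProb := by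
  rw [← integral_finsetSum _ fun i _ => integrable_mul_spectralDensity hf (b i),
    ← integral_const_mul]
  congr 1
  ext φ
  rw [← Finset.mul_sum, sum_spectralDensity, mul_comm]

lemma Matrix.IsHermitian.sum_eigenvalues_sq {d : ℕ} {A : Matrix (Fin d) (Fin d) ℂ}
    (hA : A.IsHermitian) : ∑ i, hA.eigenvalues i ^ 2 = ∑ h, ∑ k, ‖A h k‖ ^ 2 := by
  have h1 : ∀ i, hA.eigenvalues i ^ 2
      = ∑ h, ‖A.mulVec (hA.eigenvectorBasis i).ofLp h‖ ^ 2 := by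
    intro i
    have h := EuclideanSpace.norm_sq_eq (hA.eigenvectorBasis i)
    rw [hA.eigenvectorBasis.norm_eq_one] at h
    rw [hA.mulVec_eigenvectorBasis]
    simp only [Pi.smul_apply, norm_smul, mul_pow, ← Finset.mul_sum, ← h]
    simp
  have h2 : ∀ i h, A.mulVec (hA.eigenvectorBasis i).ofLp h
      = inner ℂ (WithLp.toLp 2 fun k => star (A h k)) (hA.eigenvectorBasis i) := by
    intro i h
    simp [Matrix.mulVec, dotProduct, PiLp.inner_apply, mul_comm]
  simp_rw [h1, h2]
  rw [Finset.sum_comm]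
  refine Finset.sum_congr rfl fun h _ => ?_
  rw [OrthonormalBasis.sum_sq_norm_inner_left, EuclideanSpace.norm_sq_eq]
  simp

lemma Matrix.IsHermitian.dotProduct_mulVec_eq_sum {d : ℕ} {A : Matrix (Fin d) (Fin d) ℂ}
    (hA : A.IsHermitian) (v : EuclideanSpace ℂ (Fin d)) :
    star v.ofLp ⬝ᵥ A.mulVec v.ofLp
      = ((∑ j, ‖inner ℂ (hA.eigenvectorBasis j) v‖ ^ 2 * hA.eigenvalues j : ℝ) : ℂ) := by
  have h1 : star v.ofLp ⬝ᵥ A.mulVec v.ofLp = inner ℂ v (WithLp.toLp 2 (A.mulVec v.ofLp)) := by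
    rw [EuclideanSpace.inner_eq_star_dotProduct, dotProduct_comm]
  rw [h1, ← hA.eigenvectorBasis.sum_inner_mul_inner, Complex.ofReal_sum]
  refine Finset.sum_congr rfl fun j _ => ?_
  have h2 : inner ℂ (hA.eigenvectorBasis j) (WithLp.toLp 2 (A.mulVec v.ofLp))
      = hA.eigenvalues j * inner ℂ (hA.eigenvectorBasis j) v := by
    have h3 : Matrix.vecMul (star (hA.eigenvectorBasis j).ofLp) A
        = star (A.mulVec (hA.eigenvectorBasis j).ofLp) := by
      rw [Matrix.star_mulVec, hA.eq]
    rw [EuclideanSpace.inner_eq_star_dotProduct, EuclideanSpace.inner_eq_star_dotProduct,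
      dotProduct_comm, Matrix.dotProduct_mulVec, h3, hA.mulVec_eigenvectorBasis,
      dotProduct_comm v.ofLp, star_smul, smul_dotProduct]
    simp
  rw [h2, ← inner_conj_symm v, Complex.ofReal_mul, Complex.ofReal_pow, ← Complex.conj_mul']
  ring

lemma Matrix.IsHermitian.sum_comp_le_sum_eigenvalues {d : ℕ} {A : Matrix (Fin d) (Fin d) ℂ}
    (hA : A.IsHermitian) (hA0 : ∀ j, 0 ≤ hA.eigenvalues j) {g : ℝ → ℝ}
    (hg : ConvexOn ℝ (Set.Ici 0) g) (hg' : MonotoneOn g (Set.Ici 0))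
    (u : OrthonormalBasis (Fin d) ℂ (EuclideanSpace ℂ (Fin d))) {x : Fin d → ℝ}
    (hx0 : ∀ i, 0 ≤ x i)
    (hx : ∀ i, x i ≤ (star (u i).ofLp ⬝ᵥ A.mulVec (u i).ofLp).re) :
    ∑ i, g (x i) ≤ ∑ j, g (hA.eigenvalues j) := by
  have key : ∀ i, g (x i) ≤ ∑ j, ‖inner ℂ (hA.eigenvectorBasis j) (u i)‖ ^ 2 *
      g (hA.eigenvalues j) := by
    intro i
    have hxi := hx i
    rw [hA.dotProduct_mulVec_eq_sum, Complex.ofReal_re] at hxi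
    refine (hg' (hx0 i) ((hx0 i).trans hxi) hxi).trans ?_
    refine hg.map_sum_le (fun _ _ => sq_nonneg _) ?_ fun j _ => hA0 j
    rw [OrthonormalBasis.sum_sq_norm_inner_right, u.norm_eq_one, one_pow]
  refine (Finset.sum_le_sum fun i _ => key i).trans_eq ?_
  rw [Finset.sum_comm]
  refine Finset.sum_congr rfl fun j _ => ?_
  rw [← Finset.sum_mul, OrthonormalBasis.sum_sq_norm_inner_left,
    hA.eigenvectorBasis.norm_eq_one, one_pow, one_mul]

lemma eigenvalues_toeplitz_nonneg {a : ℝ → ℝ} (ha : Integrable a circleProb) (ha0 : ∀ φ, 0 ≤ a φ)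
    {d : ℕ} (i : Fin d) : 0 ≤ (toeplitz_isHermitian a d).eigenvalues i := by
  rw [eigenvalues_toeplitz ha]
  exact integral_nonneg fun φ => mul_nonneg (ha0 φ) (spectralDensity_nonneg _ _)

lemma eigenvalues_toeplitz_le {a : ℝ → ℝ} (ha : Integrable a circleProb) {M : ℝ}
    (haM : ∀ φ, a φ ≤ M) {d : ℕ} (i : Fin d) : (toeplitz_isHermitian a d).eigenvalues i ≤ M := by
  rw [eigenvalues_toeplitz ha]
  calc _ ≤ ∫ φ, M * spectralDensity ((toeplitz_isHermitian a d).eigenvectorBasis i) φ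
        ∂circleProb :=
        integral_mono (integrable_mul_spectralDensity ha _)
          (integrable_mul_spectralDensity (integrable_const M) _)
          fun φ => mul_le_mul_of_nonneg_right (haM φ) (spectralDensity_nonneg _ _)
    _ = M := by
        rw [integral_const_mul, integral_spectralDensity, OrthonormalBasis.norm_eq_one]; simp

lemma sum_eigenvalues_toeplitz_mono {a b : ℝ → ℝ} (ha : Integrable a circleProb)
    (hb : Integrable b circleProb) (hb0 : ∀ φ, 0 ≤ b φ) (hba : ∀ φ, b φ ≤ a φ) {g : ℝ → ℝ}
    (hg : ConvexOn ℝ (Set.Ici 0) g) (hg' : MonotoneOn g (Set.Ici 0)) (d : ℕ) :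
    ∑ i, g ((toeplitz_isHermitian b d).eigenvalues i)
      ≤ ∑ i, g ((toeplitz_isHermitian a d).eigenvalues i) := by
  refine (toeplitz_isHermitian a d).sum_comp_le_sum_eigenvalues
    (eigenvalues_toeplitz_nonneg ha fun φ => (hb0 φ).trans (hba φ)) hg hg'
    (toeplitz_isHermitian b d).eigenvectorBasis (eigenvalues_toeplitz_nonneg hb hb0) fun i => ?_
  rw [eigenvalues_toeplitz hb, dotProduct_toeplitz_mulVec ha, Complex.ofReal_re]
  exact integral_mono (integrable_mul_spectralDensity hb _) (integrable_mul_spectralDensity ha _)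
    fun φ => mul_le_mul_of_nonneg_right (hba φ) (spectralDensity_nonneg _ _)

lemma ConvexOn.map_integral_mul_spectralDensity_le {a : ℝ → ℝ} (ha : Integrable a circleProb)
    (ha0 : ∀ φ, 0 ≤ a φ) {g : ℝ → ℝ} (hg : ConvexOn ℝ (Set.Ici 0) g)
    (hgc : ContinuousOn g (Set.Ici 0)) (hga : Integrable (fun φ => g (a φ)) circleProb) {d : ℕ}
    {v : EuclideanSpace ℂ (Fin d)} (hv : ‖v‖ = 1) :
    g (∫ φ, a φ * spectralDensity v φ ∂circleProb)
      ≤ ∫ φ, g (a φ) * spectralDensity v φ ∂circleProb := by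
  have hm : Measurable fun φ => (spectralDensity v φ).toNNReal :=
    (continuous_spectralDensity v).measurable.real_toNNReal
  have hint : ∀ f : ℝ → ℝ, ∫ φ, f φ ∂circleProb.withDensity
      (fun φ => ((spectralDensity v φ).toNNReal : ENNReal))
      = ∫ φ, f φ * spectralDensity v φ ∂circleProb := by
    intro f
    rw [integral_withDensity_eq_integral_smul hm]
    congr 1
    ext φ
    rw [NNReal.smul_def, Real.coe_toNNReal _ (spectralDensity_nonneg v φ), smul_eq_mul, mul_comm]
  have hintble : ∀ f : ℝ → ℝ, Integrable f circleProb → Integrable f (circleProb.withDensity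
      (fun φ => ((spectralDensity v φ).toNNReal : ENNReal))) := by
    intro f hf
    rw [integrable_withDensity_iff_integrable_smul hm]
    convert integrable_mul_spectralDensity hf v using 2 with φ
    rw [NNReal.smul_def, Real.coe_toNNReal _ (spectralDensity_nonneg v φ), smul_eq_mul, mul_comm]
  have hprob : IsProbabilityMeasure (circleProb.withDensity
      (fun φ => ((spectralDensity v φ).toNNReal : ENNReal))) := by
    constructor
    rw [withDensity_apply _ MeasurableSet.univ, Measure.restrict_univ]
    have h1 : Integrable (spectralDensity v) circleProb := by
      simpa using integrable_mul_spectralDensity (integrable_const (1 : ℝ)) v (μ := circleProb)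
    have := ofReal_integral_eq_lintegral_ofReal h1
      (Eventually.of_forall fun φ => spectralDensity_nonneg v φ)
    rw [integral_spectralDensity, hv] at this
    simpa [ENNReal.ofReal] using this.symm
  rw [← hint a, ← hint fun φ => g (a φ)]
  exact hg.map_integral_le hgc isClosed_Ici (Eventually.of_forall ha0) (hintble a ha)
    (hintble _ hga)

lemma sum_eigenvalues_toeplitz_le {a : ℝ → ℝ} (ha : Integrable a circleProb)
    (ha0 : ∀ φ, 0 ≤ a φ) {g : ℝ → ℝ} (hg : ConvexOn ℝ (Set.Ici 0) g)
    (hgc : ContinuousOn g (Set.Ici 0)) (hga : Integrable (fun φ => g (a φ)) circleProb) (d : ℕ) :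
    ∑ i, g ((toeplitz_isHermitian a d).eigenvalues i) ≤ d * ∫ φ, g (a φ) ∂circleProb := by
  rw [← sum_integral_mul_spectralDensity hga (toeplitz_isHermitian a d).eigenvectorBasis]
  refine Finset.sum_le_sum fun i _ => ?_
  rw [eigenvalues_toeplitz ha]
  exact hg.map_integral_mul_spectralDensity_le ha ha0 hgc hga (OrthonormalBasis.norm_eq_one _ _)

lemma sum_sub_eq_sum_partial_sums (f : ℤ → ℝ) (d : ℕ) :
    ∑ h : Fin d, ∑ k : Fin d, f ((h : ℕ) - (k : ℕ))
      = ∑ n ∈ Finset.range d, (∑ i ∈ Finset.range (n + 1), (f i + f (-i)) - f 0) := by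
  have h0 : ∑ h : Fin d, ∑ k : Fin d, f ((h : ℕ) - (k : ℕ))
      = ∑ h ∈ Finset.range d, ∑ k ∈ Finset.range d, f ((h : ℤ) - (k : ℤ)) := by
    rw [← Fin.sum_univ_eq_sum_range (fun h => ∑ k ∈ Finset.range d, f ((h : ℤ) - (k : ℤ)))]
    refine Finset.sum_congr rfl fun h _ => ?_
    rw [← Fin.sum_univ_eq_sum_range (fun k => f (((h : ℕ) : ℤ) - (k : ℤ)))]
  rw [h0]
  clear h0
  induction d with
  | zero => simp
  | succ d ih =>
    rw [Finset.sum_range_succ (fun n => ∑ i ∈ Finset.range (n + 1), (f i + f (-i)) - f 0), ← ih]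
    rw [Finset.sum_range_succ]
    simp_rw [Finset.sum_range_succ (fun k : ℕ => f (_ - (k : ℤ)))]
    rw [Finset.sum_add_distrib, Finset.sum_range_succ' (fun i : ℕ => f i + f (-i)),
      Finset.sum_add_distrib]
    have h1 : ∑ x ∈ Finset.range d, f ((x : ℤ) - d)
        = ∑ x ∈ Finset.range d, f (-((x + 1 : ℕ) : ℤ)) := by
      rw [← Finset.sum_range_reflect]
      refine Finset.sum_congr rfl fun x hx => ?_
      rw [Finset.mem_range] at hx
      congr 1
      omega
    have h2 : ∑ x ∈ Finset.range d, f ((d : ℤ) - x)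
        = ∑ x ∈ Finset.range d, f (((x + 1 : ℕ) : ℤ)) := by
      rw [← Finset.sum_range_reflect]
      refine Finset.sum_congr rfl fun x hx => ?_
      rw [Finset.mem_range] at hx
      congr 1
      omega
    rw [h1, h2]
    simp only [sub_self, Nat.cast_zero, neg_zero]
    ring

lemma tendsto_mean_sum_sub {f : ℤ → ℝ} {s : ℝ} (hf : HasSum f s) :
    Tendsto (fun d : ℕ => (1 / (d : ℝ)) * ∑ h : Fin d, ∑ k : Fin d, f ((h : ℕ) - (k : ℕ)))
      atTop (nhds s) := by
  simp_rw [sum_sub_eq_sum_partial_sums, one_div]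
  refine Tendsto.cesaro ?_
  have h := hf.nat_add_neg.tendsto_sum_nat
  have h2 := ((tendsto_add_atTop_iff_nat 1).2 h).sub_const (f 0)
  simpa using h2

lemma toeplitz_apply_eq_fourierCoeffOn (a : ℝ → ℝ) (hπ : -π < π) (d : ℕ) (h k : Fin d) :
    toeplitz a d h k = fourierCoeffOn hπ (fun φ => (a φ : ℂ)) ((h : ℕ) - (k : ℕ)) := by
  rw [toeplitz, Matrix.of_apply, integral_circleProb, fourierCoeffOn_eq_integral]
  have h2 : π - -π = 2 * π := by ring
  rw [h2]
  congr 1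
  refine intervalIntegral.integral_congr fun φ _ => ?_
  simp only [smul_eq_mul, mul_comm (a φ : ℂ)]
  rw [fourier_coe_apply]
  congr 2
  have : (π : ℂ) ≠ 0 := by exact_mod_cast Real.pi_ne_zero
  push_cast
  field_simp

lemma tendsto_mean_eigenvalues_toeplitz_sq {b : ℝ → ℝ}
    (hb : MemLp b 2 (volume.restrict (Set.Ioc (-π) π))) :
    Tendsto (fun d : ℕ => (1 / (d : ℝ)) * ∑ i, (toeplitz_isHermitian b d).eigenvalues i ^ 2)
      atTop (nhds (∫ φ, b φ ^ 2 ∂circleProb)) := by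
  have hπ : -π < π := by linarith [Real.pi_pos]
  have h := tendsto_mean_sum_sub (hasSum_sq_fourierCoeffOn hπ (hb.ofReal (K := ℂ)))
  have h2 : π - -π = 2 * π := by ring
  simp_rw [(toeplitz_isHermitian b _).sum_eigenvalues_sq, toeplitz_apply_eq_fourierCoeffOn b hπ]
  rw [integral_circleProb, one_div]
  simpa [h2] using h

lemma ContinuousOn.exists_abs_sub_le_add_sq {g : ℝ → ℝ} {s : Set ℝ} (hs : IsCompact s)
    (hg : ContinuousOn g s) {ε : ℝ} (hε : 0 < ε) :
    ∃ K, ∀ x ∈ s, ∀ y ∈ s, |g x - g y| ≤ ε + K * (x - y) ^ 2 := by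
  obtain ⟨B, hB⟩ := hs.exists_bound_of_continuousOn hg
  obtain ⟨δ, hδ, h⟩ := Metric.uniformContinuousOn_iff.1
    (hs.uniformContinuousOn_of_continuous hg) ε hε
  refine ⟨2 * B / δ ^ 2, fun x hx y hy => ?_⟩
  have hB0 : 0 ≤ B := (norm_nonneg _).trans (hB x hx)
  rcases lt_or_ge (dist x y) δ with hd | hd
  · have := h x hx y hy hd
    rw [Real.dist_eq] at this
    have : 0 ≤ 2 * B / δ ^ 2 * (x - y) ^ 2 := by positivity
    linarith
  · rw [Real.dist_eq] at hd
    have h1 : δ ^ 2 ≤ (x - y) ^ 2 := by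
      rw [← sq_abs (x - y)]
      gcongr
    have h2 : 2 * B ≤ 2 * B / δ ^ 2 * (x - y) ^ 2 := by
      rw [div_mul_eq_mul_div, le_div_iff₀ (by positivity)]
      gcongr
    have h3 := abs_sub (g x) (g y)
    have hx' := hB x hx
    have hy' := hB y hy
    rw [Real.norm_eq_abs] at hx' hy'
    linarith

lemma ContinuousOn.measurable_comp_nonneg {Ω : Type*} [MeasurableSpace Ω] {g : ℝ → ℝ}
    {a : Ω → ℝ} (hg : ContinuousOn g (Set.Ici 0))
    (ha : Measurable a) (ha0 : ∀ φ, 0 ≤ a φ) : Measurable fun φ => g (a φ) := by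
  have hc : Continuous fun x => g (max x 0) :=
    hg.comp_continuous (by fun_prop) fun x => Set.mem_Ici.2 (le_max_right _ _)
  convert hc.measurable.comp ha using 2 with φ
  simp [max_eq_left (ha0 φ)]

lemma integrable_comp_of_bounded {g a : ℝ → ℝ} (hg : ContinuousOn g (Set.Ici 0))
    (ha : Measurable a) (ha0 : ∀ φ, 0 ≤ a φ) {M : ℝ} (haM : ∀ φ, a φ ≤ M) :
    Integrable (fun φ => g (a φ)) circleProb := by
  obtain ⟨B, hB⟩ := (isCompact_Icc (a := 0) (b := M)).exists_bound_of_continuousOn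
    (hg.mono Set.Icc_subset_Ici_self)
  exact Integrable.of_bound (hg.measurable_comp_nonneg ha ha0).aestronglyMeasurable B
    (Eventually.of_forall fun φ => hB _ ⟨ha0 φ, haM φ⟩)

lemma abs_mean_sub_integral_le {b : ℝ → ℝ} (hb : Measurable b) (hb0 : ∀ φ, 0 ≤ b φ) {M : ℝ}
    (hbM : ∀ φ, b φ ≤ M) {g : ℝ → ℝ} (hg : ContinuousOn g (Set.Ici 0)) {ε K : ℝ}
    (hK : ∀ x ∈ Set.Icc 0 M, ∀ y ∈ Set.Icc 0 M, |g x - g y| ≤ ε + K * (x - y) ^ 2)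
    {d : ℕ} (hd : d ≠ 0) :
    |(1 / (d : ℝ)) * ∑ i, g ((toeplitz_isHermitian b d).eigenvalues i)
        - ∫ φ, g (b φ) ∂circleProb|
      ≤ ε + K * ((∫ φ, b φ ^ 2 ∂circleProb)
        - (1 / (d : ℝ)) * ∑ i, (toeplitz_isHermitian b d).eigenvalues i ^ 2) := by
  set v := (toeplitz_isHermitian b d).eigenvectorBasis
  set x := (toeplitz_isHermitian b d).eigenvalues
  have hbi : Integrable b circleProb :=
    integrable_comp_of_bounded (g := id) continuousOn_id hb hb0 hbM
  have hb2 : Integrable (fun φ => b φ ^ 2) circleProb :=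
    integrable_comp_of_bounded (g := fun x => x ^ 2) (by fun_prop) hb hb0 hbM
  have hgb := integrable_comp_of_bounded hg hb hb0 hbM
  have hxm : ∀ i, x i ∈ Set.Icc 0 M := fun i =>
    ⟨eigenvalues_toeplitz_nonneg hbi hb0 i, eigenvalues_toeplitz_le hbi hbM i⟩
  have hv : ∀ i, ∫ φ, spectralDensity (v i) φ ∂circleProb = 1 := fun i => by
    rw [integral_spectralDensity, v.norm_eq_one, one_pow]
  have hi1 : ∀ i c, Integrable (fun φ => c * spectralDensity (v i) φ) circleProb := fun i c =>
    integrable_mul_spectralDensity (integrable_const c) _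
  have key : ∀ i, |g (x i) - ∫ φ, g (b φ) * spectralDensity (v i) φ ∂circleProb|
      ≤ ε + K * ((∫ φ, b φ ^ 2 * spectralDensity (v i) φ ∂circleProb) - x i ^ 2) := by
    intro i
    have e1 : g (x i) - ∫ φ, g (b φ) * spectralDensity (v i) φ ∂circleProb
        = ∫ φ, (g (x i) * spectralDensity (v i) φ - g (b φ) * spectralDensity (v i) φ)
          ∂circleProb := by
      rw [integral_sub (hi1 i _) (integrable_mul_spectralDensity hgb _), integral_const_mul, hv,
        mul_one]
    have e2 : ∫ φ, ((ε + K * x i ^ 2) * spectralDensity (v i) φ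
        - 2 * K * x i * (b φ * spectralDensity (v i) φ)
        + K * (b φ ^ 2 * spectralDensity (v i) φ)) ∂circleProb
        = ε + K * ((∫ φ, b φ ^ 2 * spectralDensity (v i) φ ∂circleProb) - x i ^ 2) := by
      have hi2 : Integrable (fun φ => (ε + K * x i ^ 2) * spectralDensity (v i) φ
          - 2 * K * x i * (b φ * spectralDensity (v i) φ)) circleProb :=
        (hi1 i _).sub ((integrable_mul_spectralDensity hbi _).const_mul _)
      rw [integral_add hi2 ((integrable_mul_spectralDensity hb2 _).const_mul _),
        integral_sub (hi1 i _) ((integrable_mul_spectralDensity hbi _).const_mul _),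
        integral_const_mul, integral_const_mul, integral_const_mul, hv,
        ← eigenvalues_toeplitz hbi i]
      ring
    rw [e1, ← e2]
    refine abs_integral_le_integral_abs.trans (integral_mono ?_ ?_ fun φ => ?_)
    · exact ((hi1 i _).sub (integrable_mul_spectralDensity hgb _)).abs
    · exact ((hi1 i _).sub ((integrable_mul_spectralDensity hbi _).const_mul _)).add
        ((integrable_mul_spectralDensity hb2 _).const_mul _)
    · have hp := spectralDensity_nonneg (v i) φ
      have := mul_le_mul_of_nonneg_right (hK _ (hxm i) _ ⟨hb0 φ, hbM φ⟩) hp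
      simp only
      rw [← sub_mul, abs_mul, abs_of_nonneg hp]
      refine this.trans_eq ?_
      ring
  have hd' : (0 : ℝ) < d := by positivity
  have hsum : |∑ i, g (x i) - d * ∫ φ, g (b φ) ∂circleProb|
      ≤ d * ε + K * (d * (∫ φ, b φ ^ 2 ∂circleProb) - ∑ i, x i ^ 2) := by
    rw [← sum_integral_mul_spectralDensity hgb v, ← sum_integral_mul_spectralDensity hb2 v,
      ← Finset.sum_sub_distrib, ← Finset.sum_sub_distrib]
    refine (Finset.abs_sum_le_sum_abs _ _).trans ((Finset.sum_le_sum fun i _ => key i).trans_eq ?_)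
    rw [Finset.sum_add_distrib, Finset.mul_sum]
    simp
  have e3 : (1 / (d : ℝ)) * ∑ i, g (x i) - ∫ φ, g (b φ) ∂circleProb
      = (∑ i, g (x i) - d * ∫ φ, g (b φ) ∂circleProb) / d := by
    field_simp
  rw [e3, abs_div, abs_of_pos hd', div_le_iff₀ hd']
  refine hsum.trans_eq ?_
  field_simp

lemma tendsto_mean_eigenvalues_toeplitz_of_bounded {b : ℝ → ℝ} (hb : Measurable b)
    (hb0 : ∀ φ, 0 ≤ b φ) {M : ℝ} (hbM : ∀ φ, b φ ≤ M) {g : ℝ → ℝ}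
    (hg : ContinuousOn g (Set.Ici 0)) :
    Tendsto (fun d : ℕ => (1 / (d : ℝ)) * ∑ i, g ((toeplitz_isHermitian b d).eigenvalues i))
      atTop (nhds (∫ φ, g (b φ) ∂circleProb)) := by
  have hmem : MemLp b 2 (volume.restrict (Set.Ioc (-π) π)) :=
    MemLp.of_bound hb.aestronglyMeasurable M
      (Eventually.of_forall fun φ => by rw [Real.norm_of_nonneg (hb0 φ)]; exact hbM φ)
  have hsq := tendsto_mean_eigenvalues_toeplitz_sq hmem
  rw [Metric.tendsto_nhds]
  intro ε hε
  obtain ⟨K, hK⟩ := ContinuousOn.exists_abs_sub_le_add_sq (isCompact_Icc (a := 0) (b := M))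
    (hg.mono Set.Icc_subset_Ici_self) (half_pos hε)
  have h0 := (hsq.const_sub (∫ φ, b φ ^ 2 ∂circleProb)).const_mul K
  rw [sub_self, mul_zero] at h0
  filter_upwards [h0.eventually_lt_const (half_pos hε), eventually_ne_atTop 0] with d hd hd0
  rw [Real.dist_eq]
  have := abs_mean_sub_integral_le hb hb0 hbM hg hK hd0
  linarith

lemma tendsto_mean_eigenvalues_toeplitz_of_convexOn {a : ℝ → ℝ} (ham : Measurable a)
    (ha : Integrable a circleProb) (ha0 : ∀ φ, 0 ≤ a φ) {g : ℝ → ℝ}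
    (hg : ConvexOn ℝ (Set.Ici 0) g) (hgm : MonotoneOn g (Set.Ici 0))
    (hgc : ContinuousOn g (Set.Ici 0)) (hga : Integrable (fun φ => g (a φ)) circleProb) :
    Tendsto (fun d : ℕ => (1 / (d : ℝ)) * ∑ i, g ((toeplitz_isHermitian a d).eigenvalues i))
      atTop (nhds (∫ φ, g (a φ) ∂circleProb)) := by
  have hb0 : ∀ (n : ℕ) φ, 0 ≤ min (a φ) n := fun n φ => le_min (ha0 φ) (Nat.cast_nonneg n)
  have htrunc : Tendsto (fun n : ℕ => ∫ φ, g (min (a φ) n) ∂circleProb) atTop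
      (nhds (∫ φ, g (a φ) ∂circleProb)) := by
    refine tendsto_integral_of_dominated_convergence (fun φ => |g 0| + |g (a φ)|)
      (fun n => (hgc.measurable_comp_nonneg (ham.min measurable_const)
        (hb0 n)).aestronglyMeasurable) ((integrable_const _).add hga.abs) ?_ ?_
    · refine fun n => Eventually.of_forall fun φ => ?_
      have h1 := hgm (Set.mem_Ici.2 le_rfl) (Set.mem_Ici.2 (hb0 n φ)) (hb0 n φ)
      have h2 := hgm (Set.mem_Ici.2 (hb0 n φ)) (Set.mem_Ici.2 (ha0 φ)) (min_le_left _ _)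
      rw [Real.norm_eq_abs, abs_le]
      constructor
      · linarith [neg_abs_le (g 0), abs_nonneg (g (a φ))]
      · linarith [le_abs_self (g (a φ)), abs_nonneg (g 0)]
    · refine Eventually.of_forall fun φ => tendsto_const_nhds.congr' ?_
      filter_upwards [eventually_ge_atTop ⌈a φ⌉₊] with n hn
      rw [min_eq_left (Nat.ceil_le.1 hn)]
  rw [tendsto_order]
  constructor
  · intro c hc
    obtain ⟨n, hn⟩ := (htrunc.eventually_const_lt hc).exists
    have hbm : Measurable fun φ => min (a φ) (n : ℝ) := ham.min measurable_const
    have hbM : ∀ φ, min (a φ) (n : ℝ) ≤ n := fun φ => min_le_right _ _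
    filter_upwards [(tendsto_mean_eigenvalues_toeplitz_of_bounded hbm (hb0 n) hbM
      hgc).eventually_const_lt hn] with d hd
    refine hd.trans_le (mul_le_mul_of_nonneg_left ?_ (by positivity))
    exact sum_eigenvalues_toeplitz_mono ha
      (integrable_comp_of_bounded (g := id) continuousOn_id hbm (hb0 n) hbM) (hb0 n)
      (fun φ => min_le_left _ _) hg hgm d
  · intro c hc
    filter_upwards [eventually_ne_atTop 0] with d hd
    refine lt_of_le_of_lt ?_ hc
    have hd' : (0 : ℝ) < d := by positivity
    rw [one_div, inv_mul_le_iff₀ hd']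
    exact sum_eigenvalues_toeplitz_le ha ha0 hg hgc hga d

/-- `F ∘ a` is integrable for `μ`, and the averages of `F` over the rows of the triangular array
`x` converge to its integral. -/
def MeanTendsto {Ω : Type*} [MeasurableSpace Ω] (μ : Measure Ω) (a : Ω → ℝ)
    (x : (d : ℕ) → Fin d → ℝ) (F : ℝ → ℝ) : Prop :=
  Integrable (fun φ => F (a φ)) μ ∧
    Tendsto (fun d : ℕ => (1 / (d : ℝ)) * ∑ i, F (x d i)) atTop (nhds (∫ φ, F (a φ) ∂μ))

namespace MeanTendsto

variable {Ω : Type*} [MeasurableSpace Ω] {μ : Measure Ω} {a : Ω → ℝ}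
  {x : (d : ℕ) → Fin d → ℝ} {F G W : ℝ → ℝ}

lemma add (hF : MeanTendsto μ a x F) (hG : MeanTendsto μ a x G) :
    MeanTendsto μ a x fun t => F t + G t := by
  refine ⟨hF.1.add hG.1, ?_⟩
  rw [integral_add hF.1 hG.1]
  simpa only [Finset.sum_add_distrib, mul_add] using hF.2.add hG.2

lemma const_mul (c : ℝ) (hF : MeanTendsto μ a x F) : MeanTendsto μ a x fun t => c * F t := by
  refine ⟨hF.1.const_mul c, ?_⟩
  rw [integral_const_mul]
  simpa only [← Finset.mul_sum, mul_left_comm _ c] using hF.2.const_mul c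

lemma sub (hF : MeanTendsto μ a x F) (hG : MeanTendsto μ a x G) :
    MeanTendsto μ a x fun t => F t - G t := by
  simpa [sub_eq_add_neg] using hF.add (hG.const_mul (-1))

lemma const [IsProbabilityMeasure μ] (c : ℝ) : MeanTendsto μ a x fun _ => c := by
  refine ⟨integrable_const c, tendsto_const_nhds.congr' ?_⟩
  filter_upwards [eventually_ne_atTop 0] with d hd
  have : (d : ℝ) ≠ 0 := by exact_mod_cast hd
  simp [this]

lemma congr (ha : ∀ φ, 0 ≤ a φ) (hx : ∀ d i, 0 ≤ x d i) (hF : MeanTendsto μ a x F)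
    (h : ∀ t, 0 ≤ t → F t = G t) : MeanTendsto μ a x G := by
  have h1 : ∀ φ, F (a φ) = G (a φ) := fun φ => h _ (ha φ)
  have h2 : ∀ d i, F (x d i) = G (x d i) := fun d i => h _ (hx d i)
  simpa only [MeanTendsto, h1, h2] using hF

lemma of_approx (ha : ∀ φ, 0 ≤ a φ) (hx : ∀ d i, 0 ≤ x d i)
    (hF : Integrable (fun φ => F (a φ)) μ)
    (h : ∀ ε > 0, ∃ G W, MeanTendsto μ a x G ∧ MeanTendsto μ a x W ∧
      (∀ t, 0 ≤ t → |F t - G t| ≤ W t) ∧ ∫ φ, W (a φ) ∂μ < ε) :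
    MeanTendsto μ a x F := by
  refine ⟨hF, ?_⟩
  rw [Metric.tendsto_nhds]
  intro ε hε
  obtain ⟨G, W, hG, hW, hFG, hWε⟩ := h (ε / 3) (by positivity)
  filter_upwards [Metric.tendsto_nhds.1 hG.2 (ε / 3) (by positivity),
    hW.2.eventually_lt_const hWε] with d h1 h2
  rw [Real.dist_eq] at h1 ⊢
  have h3 : |(1 / (d : ℝ)) * ∑ i, F (x d i) - (1 / (d : ℝ)) * ∑ i, G (x d i)|
      ≤ (1 / (d : ℝ)) * ∑ i, W (x d i) := by
    rw [← mul_sub, ← Finset.sum_sub_distrib, abs_mul,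
      abs_of_nonneg (by positivity : 0 ≤ 1 / (d : ℝ))]
    refine mul_le_mul_of_nonneg_left ?_ (by positivity)
    exact (Finset.abs_sum_le_sum_abs _ _).trans
      (Finset.sum_le_sum fun i _ => hFG _ (hx d i))
  have h4 : |∫ φ, F (a φ) ∂μ - ∫ φ, G (a φ) ∂μ| ≤ ∫ φ, W (a φ) ∂μ := by
    rw [← integral_sub hF hG.1]
    exact abs_integral_le_integral_abs.trans
      (integral_mono (hF.sub hG.1).abs hW.1 fun φ => hFG _ (ha φ))
  rw [abs_le] at h3 h4
  rw [abs_lt] at h1 ⊢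
  constructor <;> linarith [h1.1, h1.2, h3.1, h3.2, h4.1, h4.2]

/-- Convergence against all exponentials implies convergence against continuous functions that
are eventually constant. -/
lemma of_exp [IsProbabilityMeasure μ] (ham : Measurable a) (ha : ∀ φ, 0 ≤ a φ)
    (hx : ∀ d i, 0 ≤ x d i) (hexp : ∀ k : ℕ, MeanTendsto μ a x fun t => Real.exp (-(k * t)))
    (hF : ContinuousOn F (Set.Ici 0)) {R : ℝ} (hR : 0 ≤ R) (hFR : ∀ t, R ≤ t → F t = F R) :
    MeanTendsto μ a x F := by
  have hpoly : ∀ p : Polynomial ℝ, MeanTendsto μ a x fun t => p.eval (Real.exp (-t)) := by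
    intro p
    induction p using Polynomial.induction_on' with
    | add p q hp hq => simpa only [Polynomial.eval_add] using hp.add hq
    | monomial k c =>
      simpa only [Polynomial.eval_monomial, ← Real.exp_nat_mul, mul_neg] using
        (hexp k).const_mul c
  have hmin : ∀ t, F t = F (min t R) := by
    intro t
    rcases le_total t R with h | h
    · rw [min_eq_left h]
    · rw [min_eq_right h, hFR t h]
  have hlog : ∀ t, F t = F (-Real.log (max (Real.exp (-t)) (Real.exp (-R)))) := by
    intro t
    rw [← Real.exp_monotone.map_max, Real.log_exp, max_neg_neg, neg_neg, ← hmin]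
  have hpos : ∀ y, 0 < max y (Real.exp (-R)) := fun y =>
    (Real.exp_pos _).trans_le (le_max_right _ _)
  have hcont : ContinuousOn (fun y => F (-Real.log (max y (Real.exp (-R))))) (Set.Icc 0 1) := by
    refine hF.comp (Continuous.continuousOn ?_) ?_
    · exact (Continuous.log (by fun_prop) fun y => (hpos y).ne').neg
    · intro y hy
      have h1 : max y (Real.exp (-R)) ≤ 1 := max_le hy.2 (Real.exp_le_one_iff.2 (by linarith))
      exact Set.mem_Ici.2 (neg_nonneg.2 (Real.log_nonpos (hpos y).le h1))
  refine of_approx ha hx ?_ fun ε hε => ?_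
  · obtain ⟨B, hB⟩ := (isCompact_Icc (a := 0) (b := R)).exists_bound_of_continuousOn
      (hF.mono Set.Icc_subset_Ici_self)
    refine Integrable.of_bound (hF.measurable_comp_nonneg ham ha).aestronglyMeasurable B
      (Eventually.of_forall fun φ => ?_)
    rw [hmin]
    exact hB _ ⟨le_min (ha φ) hR, min_le_right _ _⟩
  · obtain ⟨p, hp⟩ := exists_polynomial_near_of_continuousOn 0 1 _ hcont (ε / 2) (by positivity)
    refine ⟨_, _, hpoly p, const (ε / 2), fun t ht => ?_, ?_⟩
    · have := hp (Real.exp (-t)) ⟨(Real.exp_pos _).le, Real.exp_le_one_iff.2 (by linarith)⟩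
      rw [abs_sub_comm] at this
      rw [hlog t]
      exact this.le
    · simpa using hε

/-- Convergence against all exponentials and against `t ^ α` implies convergence against
continuous functions of growth `t ^ α`. -/
lemma of_growth [IsProbabilityMeasure μ] (ham : Measurable a) (ha : ∀ φ, 0 ≤ a φ)
    (hx : ∀ d i, 0 ≤ x d i) (hexp : ∀ k : ℕ, MeanTendsto μ a x fun t => Real.exp (-(k * t)))
    {α : ℝ} (hα : 0 ≤ α) (hpow : MeanTendsto μ a x fun t => t ^ α)
    (hF : ContinuousOn F (Set.Ici 0)) {C : ℝ} (hFC : ∀ t, 0 ≤ t → |F t| ≤ C * (1 + t ^ α)) :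
    MeanTendsto μ a x F := by
  have hw : MeanTendsto μ a x fun t => C * (1 + t ^ α) := ((const 1).add hpow).const_mul C
  have hwc : Continuous fun t : ℝ => C * (1 + t ^ α) := by
    have := Real.continuous_rpow_const hα
    fun_prop
  have hcut : ∀ {H : ℝ → ℝ}, ContinuousOn H (Set.Ici 0) → ∀ n : ℕ,
      MeanTendsto μ a x fun t => H t * max 0 (min 1 (n + 1 - t)) := by
    intro H hH n
    refine of_exp ham ha hx hexp (R := n + 1) (by fun_prop) (by positivity) fun t ht => ?_
    simp [max_eq_left ((min_le_right (1 : ℝ) _).trans (sub_nonpos.2 ht))]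
  have hχ0 : ∀ (n : ℕ) (t : ℝ), 0 ≤ max 0 (min 1 ((n : ℝ) + 1 - t)) := fun n t => le_max_left _ _
  have hχ1 : ∀ (n : ℕ) (t : ℝ), max 0 (min 1 ((n : ℝ) + 1 - t)) ≤ 1 := fun n t =>
    max_le zero_le_one (min_le_left _ _)
  have hw0 : ∀ t, 0 ≤ t → 0 ≤ C * (1 + t ^ α) := fun t ht => (abs_nonneg _).trans (hFC t ht)
  have hW : ∀ n : ℕ, MeanTendsto μ a x fun t =>
      C * (1 + t ^ α) - C * (1 + t ^ α) * max 0 (min 1 (n + 1 - t)) := fun n =>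
    hw.sub (hcut hwc.continuousOn n)
  refine of_approx ha hx ?_ fun ε hε => ?_
  · exact hw.1.mono' (hF.measurable_comp_nonneg ham ha).aestronglyMeasurable
      (Eventually.of_forall fun φ => hFC _ (ha φ))
  · have hlim : Tendsto (fun n : ℕ => ∫ φ, (C * (1 + a φ ^ α)
        - C * (1 + a φ ^ α) * max 0 (min 1 ((n : ℝ) + 1 - a φ))) ∂μ) atTop
        (nhds (∫ _, (0 : ℝ) ∂μ)) := by
      refine tendsto_integral_of_dominated_convergence _ (fun n => (hW n).1.aestronglyMeasurable)
        hw.1 (fun n => Eventually.of_forall fun φ => ?_) (Eventually.of_forall fun φ => ?_)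
      · have h1 := mul_nonneg (hw0 _ (ha φ)) (hχ0 n (a φ))
        have h2 := mul_le_of_le_one_right (hw0 _ (ha φ)) (hχ1 n (a φ))
        rw [Real.norm_eq_abs, abs_le]
        constructor <;> linarith [hw0 _ (ha φ)]
      · refine tendsto_const_nhds.congr' ?_
        filter_upwards [eventually_ge_atTop ⌈a φ⌉₊] with n hn
        have : (1 : ℝ) ≤ n + 1 - a φ := by linarith [Nat.ceil_le.1 hn]
        rw [min_eq_left this, max_eq_right zero_le_one]
        ring
    rw [integral_zero] at hlim
    obtain ⟨n, hn⟩ := (hlim.eventually_lt_const hε).exists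
    refine ⟨_, _, hcut hF n, hW n, fun t ht => ?_, hn⟩
    have h1 : F t - F t * max 0 (min 1 ((n : ℝ) + 1 - t))
        = F t * (1 - max 0 (min 1 ((n : ℝ) + 1 - t))) := by ring
    rw [h1, abs_mul, abs_of_nonneg (sub_nonneg.2 (hχ1 n t))]
    refine (mul_le_mul_of_nonneg_right (hFC t ht) (sub_nonneg.2 (hχ1 n t))).trans_eq ?_
    ring

end MeanTendsto

lemma meanTendsto_toeplitz_of_convexOn {a : ℝ → ℝ} (ham : Measurable a)
    (ha : Integrable a circleProb) (ha0 : ∀ φ, 0 ≤ a φ) {g : ℝ → ℝ}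
    (hg : ConvexOn ℝ (Set.Ici 0) g) (hgm : MonotoneOn g (Set.Ici 0))
    (hgc : ContinuousOn g (Set.Ici 0)) (hga : Integrable (fun φ => g (a φ)) circleProb) :
    MeanTendsto circleProb a (fun d => (toeplitz_isHermitian a d).eigenvalues) g :=
  ⟨hga, tendsto_mean_eigenvalues_toeplitz_of_convexOn ham ha ha0 hg hgm hgc hga⟩

lemma monotoneOn_exp_neg_add_linear {k : ℝ} (hk : 0 ≤ k) :
    MonotoneOn (fun t => Real.exp (-(k * t)) + k * t) (Set.Ici 0) := by
  intro s hs t ht hst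
  have hs' : 0 ≤ k * s := mul_nonneg hk hs
  have h1 : Real.exp (-(k * t)) = Real.exp (-(k * s)) * Real.exp (-(k * t - k * s)) := by
    rw [← Real.exp_add]
    congr 1
    ring
  have h2 := Real.add_one_le_exp (-(k * t - k * s))
  have h3 : Real.exp (-(k * s)) ≤ 1 := Real.exp_le_one_iff.2 (by linarith)
  have h4 := Real.exp_pos (-(k * s))
  have h5 : 0 ≤ k * t - k * s := by nlinarith
  simp only
  rw [h1]
  nlinarith

lemma meanTendsto_toeplitz_exp {a : ℝ → ℝ} (ham : Measurable a)
    (ha : Integrable a circleProb) (ha0 : ∀ φ, 0 ≤ a φ) (k : ℕ) :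
    MeanTendsto circleProb a (fun d => (toeplitz_isHermitian a d).eigenvalues)
      fun t => Real.exp (-(k * t)) := by
  have hid : MeanTendsto circleProb a (fun d => (toeplitz_isHermitian a d).eigenvalues)
      fun t => t :=
    meanTendsto_toeplitz_of_convexOn ham ha ha0 (convexOn_id (convex_Ici 0))
      (fun _ _ _ _ h => h) continuousOn_id ha
  have hlin : ConvexOn ℝ (Set.Ici 0) fun t : ℝ => k * t :=
    (convexOn_id (convex_Ici 0)).smul (Nat.cast_nonneg k)
  have hexp : ConvexOn ℝ (Set.Ici 0) fun t : ℝ => Real.exp (-(k * t)) := by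
    have := convexOn_exp.comp_linearMap ((-(k : ℝ)) • LinearMap.id)
    refine (this.subset (Set.subset_univ _) (convex_Ici 0)).congr fun t _ => ?_
    simp
  have hexpi : Integrable (fun φ => Real.exp (-(k * a φ))) circleProb := by
    refine Integrable.of_bound (by fun_prop) 1 (Eventually.of_forall fun φ => ?_)
    rw [Real.norm_of_nonneg (Real.exp_pos _).le, Real.exp_le_one_iff, neg_nonpos]
    exact mul_nonneg (Nat.cast_nonneg k) (ha0 φ)
  have h := meanTendsto_toeplitz_of_convexOn ham ha ha0 (hexp.add hlin)
    (monotoneOn_exp_neg_add_linear (Nat.cast_nonneg k)) (by fun_prop)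
    (hexpi.add (ha.const_mul _))
  simpa using h.sub (hid.const_mul k)

lemma meanTendsto_toeplitz_of_growth {a : ℝ → ℝ} (ham : Measurable a) (ha0 : ∀ φ, 0 ≤ a φ)
    {α : ℝ} (hα : 1 ≤ α) (haα : Integrable (fun φ => a φ ^ α) circleProb) {F : ℝ → ℝ}
    (hF : ContinuousOn F (Set.Ici 0)) (hFα : ∃ C M : ℝ, ∀ t : ℝ, M ≤ t → |F t| ≤ C * t ^ α) :
    MeanTendsto circleProb a (fun d => (toeplitz_isHermitian a d).eigenvalues) F := by
  have hα0 : 0 ≤ α := zero_le_one.trans hα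
  have ha : Integrable a circleProb := by
    refine ((integrable_const 1).add haα).mono' ham.aestronglyMeasurable
      (Eventually.of_forall fun φ => ?_)
    rw [Real.norm_of_nonneg (ha0 φ)]
    have h0 := Real.rpow_nonneg (ha0 φ) α
    rcases le_total (a φ) 1 with h | h
    · simp only [Pi.add_apply]
      linarith
    · have := Real.self_le_rpow_of_one_le h hα
      simp only [Pi.add_apply]
      linarith
  have hx : ∀ (d : ℕ) (i : Fin d), 0 ≤ (toeplitz_isHermitian a d).eigenvalues i :=
    fun d i => eigenvalues_toeplitz_nonneg ha ha0 i
  obtain ⟨C, M, hCM⟩ := hFα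
  obtain ⟨B, hB⟩ := (isCompact_Icc (a := 0) (b := M)).exists_bound_of_continuousOn
    (hF.mono Set.Icc_subset_Ici_self)
  refine MeanTendsto.of_growth ham ha0 hx (meanTendsto_toeplitz_exp ham ha ha0) hα0
    (meanTendsto_toeplitz_of_convexOn ham ha ha0 (convexOn_rpow hα)
      (Real.monotoneOn_rpow_Ici_of_exponent_nonneg hα0)
      (Real.continuous_rpow_const hα0).continuousOn haα) hF (C := |B| + |C|) fun t ht => ?_
  have h0 := Real.rpow_nonneg ht α
  have h1 := mul_nonneg (abs_nonneg B) h0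
  have h2 := mul_nonneg (abs_nonneg C) h0
  have h3 := mul_le_mul_of_nonneg_right (le_abs_self C) h0
  rcases le_total t M with h | h
  · have := hB t ⟨ht, h⟩
    rw [Real.norm_eq_abs] at this
    nlinarith [le_abs_self B, abs_nonneg C]
  · nlinarith [hCM t h, abs_nonneg B, abs_nonneg C]

/-- Szegő-type theorem of Serra-Capizzano, nonnegative symbols: if
`a : [-π, π] → ℝ≥0` is measurable with `∫ a^α dφ/(2π) < ∞` for some `α ≥ 1`, and
`F : ℝ≥0 → ℝ` is continuous with `F(x) = O(x^α)` as `x → ∞`, then the averaged sums of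
`F` over the eigenvalues of the `d × d` Toeplitz matrices generated by the Fourier
coefficients of `a` converge to `(1/2π) ∫ F(a(φ)) dφ` as `d → ∞`. -/
theorem szego_theorem_nonneg_symbol
    (a : ℝ → ℝ) (ha_meas : Measurable a)
    (ha_nonneg : ∀ φ ∈ Set.Icc (-π) π, 0 ≤ a φ)
    (α : ℝ) (hα : 1 ≤ α)
    (ha_int : IntegrableOn (fun φ => a φ ^ α) (Set.Icc (-π) π))
    (F : ℝ → ℝ) (hF_cont : ContinuousOn F (Set.Ici 0))
    (hF_bigO : ∃ C M : ℝ, ∀ x : ℝ, M ≤ x → |F x| ≤ C * x ^ α)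
    (T : (d : ℕ) → Matrix (Fin d) (Fin d) ℂ)
    (hT : ∀ (d : ℕ) (h k : Fin d),
      T d h k = (1 / (2 * π)) *
        ∫ φ in (-π)..π, (a φ : ℂ) * Complex.exp (-Complex.I * (((h : ℕ) : ℂ) - ((k : ℕ) : ℂ)) * φ))
    (hH : ∀ d : ℕ, (T d).IsHermitian) :
    Tendsto (fun d : ℕ => (1 / (d : ℝ)) * ∑ j : Fin d, F ((hH d).eigenvalues j))
      atTop (nhds ((1 / (2 * π)) * ∫ φ in (-π)..π, F (a φ))) := by
  have hπ : -π ≤ π := by linarith [Real.pi_pos]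
  have hmax : ∀ φ ∈ Set.Icc (-π) π, max (a φ) 0 = a φ := fun φ hφ => max_eq_left (ha_nonneg φ hφ)
  have hT' : T = toeplitz fun φ => max (a φ) 0 := by
    funext d
    ext h k
    rw [hT, toeplitz, Matrix.of_apply, integral_circleProb, Complex.real_smul]
    congr 1
    · push_cast
      rfl
    · refine intervalIntegral.integral_congr fun φ hφ => ?_
      rw [Set.uIcc_of_le hπ] at hφ
      simp only [hmax φ hφ]
  subst hT'
  have haα : Integrable (fun φ => max (a φ) 0 ^ α) circleProb := by
    rw [integrable_circleProb_iff]
    refine (ha_int.mono_set Set.Ioc_subset_Icc_self).congr_fun (fun φ hφ => ?_) measurableSet_Ioc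
    simp only [hmax φ (Set.Ioc_subset_Icc_self hφ)]
  have hlim := (meanTendsto_toeplitz_of_growth (ha_meas.max measurable_const)
    (fun φ => le_max_right (a φ) 0) hα haα hF_cont hF_bigO).2
  have hI : ∫ φ, F (max (a φ) 0) ∂circleProb = (1 / (2 * π)) * ∫ φ in (-π)..π, F (a φ) := by
    rw [integral_circleProb, smul_eq_mul]
    congr 1
    refine intervalIntegral.integral_congr fun φ hφ => ?_
    rw [Set.uIcc_of_le hπ] at hφ
    simp only [hmax φ hφ]
  rw [hI] at hlim
  exact hlim
end

section
/- Let p : [-π, π] → ℝ≥0 be a probability density function (∫_{-π}^{π} p(φ) dφ = 1) satisfying ∫_{-π}^{π} p(φ)^{α₀} dφ < ∞ for some α₀ > 1. For each d ∈ ℕ₊ let T_p⁽ᵈ⁾ be the d × d positive semidefinite matrix with entries (T_p)_{hk} = ∫_{-π}^{π} p(φ) e^{-i(h-k)φ} dφ for h, k ∈ {0, …, d-1}, and let λ₁, …, λ_d be its eigenvalues. Then lim_{d→∞} (1/d) Σ_{j=1}^{d} λ_j log₂ λ_j = ∫_{-π}^{π} p(φ) log₂(2π p(φ)) dφ = log₂(2π)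 − h(p), where h(p) = −∫_{-π}^{π} p(φ) log₂ p(φ) dφ is the differential entropy of p (with the convention 0 log₂ 0 = 0). -/
open scoped Real ComplexOrder
open MeasureTheory Filter

/-- The vector `(e^{-i h x})_h` of the first `d` characters of the circle, conjugated. -/
noncomputable def characterVector {T : ℝ} (d : ℕ) (x : AddCircle T) : EuclideanSpace ℂ (Fin d) :=
  WithLp.toLp 2 fun h => fourier (-((h : ℕ) : ℤ)) x

/-- The Fejér (Cesàro) mean of order `d` of the Fourier series of `f`. -/
noncomputable def fejerMean {T : ℝ} [Fact (0 < T)] (d : ℕ) (f : AddCircle T → ℂ)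
    (x : AddCircle T) : ℂ :=
  (d : ℂ)⁻¹ * ∑ h : Fin d, ∑ k : Fin d,
    fourierCoeff f (((h : ℕ) : ℤ) - ((k : ℕ) : ℤ)) * fourier (((h : ℕ) : ℤ) - ((k : ℕ) : ℤ)) x

section Characters

variable {T : ℝ}

lemma norm_fourier_apply (n : ℤ) (x : AddCircle T) : ‖fourier n x‖ = 1 := by
  rw [fourier_apply]; exact Circle.norm_coe _

lemma continuous_characterVector (d : ℕ) : Continuous (characterVector (T := T) d) := by
  unfold characterVector
  fun_prop

lemma norm_sq_characterVector (d : ℕ) (x : AddCircle T) : ‖characterVector d x‖ ^ 2 = d := by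
  rw [EuclideanSpace.norm_sq_eq]
  simp [characterVector, -fourier_apply, norm_fourier_apply]

lemma norm_sq_inner_characterVector {d : ℕ} (v : EuclideanSpace ℂ (Fin d)) (x : AddCircle T) :
    ((‖inner ℂ v (characterVector d x)‖ ^ 2 : ℝ) : ℂ) =
      ∑ k : Fin d, ∑ h : Fin d, starRingEnd ℂ (v k) *
        (fourier (-(((k : ℕ) : ℤ) - ((h : ℕ) : ℤ))) x * v h) := by
  have hin : inner ℂ v (characterVector d x) =
      ∑ k : Fin d, starRingEnd ℂ (v k) * fourier (-((k : ℕ) : ℤ)) x := by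
    simp [PiLp.inner_apply, characterVector, -fourier_apply, mul_comm]
  push_cast
  rw [← Complex.mul_conj', hin, map_sum, Finset.sum_mul_sum]
  refine Finset.sum_congr rfl fun k _ => Finset.sum_congr rfl fun h _ => ?_
  rw [map_mul, Complex.conj_conj, ← fourier_neg, neg_neg, neg_sub, sub_eq_add_neg, fourier_add]
  ring

variable [Fact (0 < T)]

lemma integral_fourier (n : ℤ) :
    ∫ x : AddCircle T, fourier n x ∂AddCircle.haarAddCircle = if n = 0 then 1 else 0 := by
  have h := congrFun (fourierCoeff_fourier (T := T) 0) (-n)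
  simp only [fourierCoeff, neg_neg, fourier_zero, smul_eq_mul, mul_one] at h
  rw [h, Pi.single_apply]
  simp

lemma MeasureTheory.Integrable.mul_norm_sq_inner_characterVector {d : ℕ} {f : AddCircle T → ℝ}
    (hf : Integrable f AddCircle.haarAddCircle) (v : EuclideanSpace ℂ (Fin d)) :
    Integrable (fun x => f x * ‖inner ℂ v (characterVector d x)‖ ^ 2) AddCircle.haarAddCircle := by
  have hc : Continuous fun x : AddCircle T => ‖inner ℂ v (characterVector d x)‖ ^ 2 :=
    ((continuous_const.inner (continuous_characterVector d)).norm).pow 2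
  obtain ⟨C, hC⟩ := isCompact_univ.exists_bound_of_continuousOn hc.continuousOn
  exact hf.mul_bdd hc.aestronglyMeasurable (ae_of_all _ fun x => hC x trivial)

lemma integral_mul_norm_sq_inner_characterVector {d : ℕ} {f : AddCircle T → ℂ}
    (hf : Integrable f AddCircle.haarAddCircle) (v : EuclideanSpace ℂ (Fin d)) :
    ∫ x, f x * ((‖inner ℂ v (characterVector d x)‖ ^ 2 : ℝ) : ℂ) ∂AddCircle.haarAddCircle =
      ∑ k : Fin d, ∑ h : Fin d, starRingEnd ℂ (v k) *
        (fourierCoeff f (((k : ℕ) : ℤ) - ((h : ℕ) : ℤ)) * v h) := by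
  simp_rw [norm_sq_inner_characterVector, Finset.mul_sum]
  have hterm : ∀ k h : Fin d, Integrable (fun x => f x * (starRingEnd ℂ (v k) *
        (fourier (-(((k : ℕ) : ℤ) - ((h : ℕ) : ℤ))) x * v h))) AddCircle.haarAddCircle := by
    intro k h
    have := ((hf.fourier_smul (-(((k : ℕ) : ℤ) - ((h : ℕ) : ℤ)))).const_mul
      (starRingEnd ℂ (v k))).mul_const (v h)
    refine this.congr (ae_of_all _ fun x => ?_)
    simp only [smul_eq_mul]
    ring
  rw [integral_finsetSum _ fun k _ => integrable_finsetSum _ fun h _ => hterm k h]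
  refine Finset.sum_congr rfl fun k _ => ?_
  rw [integral_finsetSum _ fun h _ => hterm k h]
  refine Finset.sum_congr rfl fun h _ => ?_
  rw [fourierCoeff, ← integral_mul_const, ← integral_const_mul]
  refine integral_congr_ae (ae_of_all _ fun x => ?_)
  simp only [smul_eq_mul]
  ring

lemma integral_norm_sq_inner_characterVector {d : ℕ} (v : EuclideanSpace ℂ (Fin d)) :
    ∫ x : AddCircle T, ‖inner ℂ v (characterVector d x)‖ ^ 2 ∂AddCircle.haarAddCircle =
      ‖v‖ ^ 2 := by
  have h := integral_mul_norm_sq_inner_characterVector (T := T) (f := fun _ => 1)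
    (integrable_const _) v
  have hc : ∀ n : ℤ, fourierCoeff (fun _ : AddCircle T => (1 : ℂ)) n = if n = 0 then 1 else 0 := by
    intro n
    simp only [fourierCoeff, smul_eq_mul, mul_one, integral_fourier, neg_eq_zero]
  simp only [one_mul, integral_complex_ofReal, hc, sub_eq_zero, Nat.cast_inj, Fin.val_inj,
    ite_mul, zero_mul, mul_ite, mul_zero, Finset.sum_ite_eq, Finset.mem_univ, if_true] at h
  rw [EuclideanSpace.norm_sq_eq]
  have h' : ∀ k : Fin d, starRingEnd ℂ (v k) * v k = ((‖v k‖ ^ 2 : ℝ) : ℂ) := by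
    intro k; push_cast; exact Complex.conj_mul' _
  simp only [h'] at h
  exact_mod_cast h

end Characters

section Hermitian

/-- The spectral decomposition of the quadratic form of a Hermitian matrix. -/
lemma Matrix.IsHermitian.sum_eigenvalues_mul_norm_sq_inner {n : Type*} [Fintype n] [DecidableEq n]
    {A : Matrix n n ℂ} (hA : A.IsHermitian) (z : EuclideanSpace ℂ n) :
    ((∑ j, hA.eigenvalues j * ‖inner ℂ (hA.eigenvectorBasis j) z‖ ^ 2 : ℝ) : ℂ) =
      ∑ h, ∑ k, starRingEnd ℂ (z h) * (A h k * z k) := by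
  have hsymm := Matrix.isSymmetric_toEuclideanLin_iff.mpr hA
  have heig : ∀ j, A.toEuclideanLin (hA.eigenvectorBasis j) =
      (hA.eigenvalues j : ℂ) • hA.eigenvectorBasis j := by
    intro j
    ext i
    have := congrFun (hA.mulVec_eigenvectorBasis j) i
    simpa [Matrix.toLpLin_apply] using this
  have h1 := hA.eigenvectorBasis.sum_inner_mul_inner z (A.toEuclideanLin z)
  have h2 : inner ℂ z (A.toEuclideanLin z) =
      ∑ h, ∑ k, starRingEnd ℂ (z h) * (A h k * z k) := by
    simp [PiLp.inner_apply, Matrix.toLpLin_apply, Matrix.mulVec, dotProduct, Finset.mul_sum,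
      mul_comm]
  rw [← h2, ← h1]
  push_cast
  refine Finset.sum_congr rfl fun j _ => ?_
  rw [← hsymm, heig, inner_smul_left, Complex.conj_ofReal, ← inner_conj_symm z,
    ← Complex.conj_mul']
  ring

lemma Matrix.IsHermitian.sum_conj_mul_eigenvectorBasis {n : Type*} [Fintype n] [DecidableEq n]
    {A : Matrix n n ℂ} (hA : A.IsHermitian) (j : n) :
    ∑ h, ∑ k, starRingEnd ℂ (hA.eigenvectorBasis j h) * (A h k * hA.eigenvectorBasis j k) =
      (hA.eigenvalues j : ℂ) := by
  rw [← hA.sum_eigenvalues_mul_norm_sq_inner (hA.eigenvectorBasis j)]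
  congr 1
  rw [Finset.sum_eq_single j]
  · simp [inner_self_eq_norm_sq_to_K]
  · intro i _ hij
    simp [hA.eigenvectorBasis.inner_eq_zero hij]
  · simp

end Hermitian

section Fejer

variable {T : ℝ} [Fact (0 < T)]

lemma continuous_fejerMean (d : ℕ) (f : AddCircle T → ℂ) : Continuous (fejerMean d f) := by
  unfold fejerMean
  fun_prop

lemma integrable_of_continuous {E : Type*} [NormedAddCommGroup E] {f : AddCircle T → E}
    (hf : Continuous f) : Integrable f AddCircle.haarAddCircle :=
  hf.integrable_of_hasCompactSupport (HasCompactSupport.of_compactSpace f)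

lemma fejerMean_add (d : ℕ) {f g : AddCircle T → ℂ}
    (hf : Integrable f AddCircle.haarAddCircle) (hg : Integrable g AddCircle.haarAddCircle)
    (x : AddCircle T) : fejerMean d (f + g) x = fejerMean d f x + fejerMean d g x := by
  simp only [fejerMean, fourierCoeff.add hf hg, Pi.add_apply, add_mul, Finset.sum_add_distrib,
    mul_add]

lemma fejerMean_smul (d : ℕ) (c : ℂ) (f : AddCircle T → ℂ) (x : AddCircle T) :
    fejerMean d (c • f) x = c * fejerMean d f x := by
  have h : ∀ n, fourierCoeff (c • f) n = c * fourierCoeff f n := fun n => by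
    simpa using fourierCoeff.const_smul f c n
  simp only [fejerMean, h, Finset.mul_sum]
  refine Finset.sum_congr rfl fun _ _ => Finset.sum_congr rfl fun _ _ => ?_
  ring

lemma fejerMean_sub (d : ℕ) {f g : AddCircle T → ℂ}
    (hf : Integrable f AddCircle.haarAddCircle) (hg : Integrable g AddCircle.haarAddCircle)
    (x : AddCircle T) : fejerMean d (f - g) x = fejerMean d f x - fejerMean d g x := by
  have h : f - g = f + (-1 : ℂ) • g := by ext; simp [sub_eq_add_neg]
  rw [h, fejerMean_add d hf (hg.smul (-1 : ℂ)), fejerMean_smul]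
  ring

lemma fejerMean_eq_integral (d : ℕ) {f : AddCircle T → ℂ}
    (hf : Integrable f AddCircle.haarAddCircle) (x : AddCircle T) :
    fejerMean d f x = (d : ℂ)⁻¹ * ∫ y, f y *
      ((‖inner ℂ (characterVector d x) (characterVector d y)‖ ^ 2 : ℝ) : ℂ)
        ∂AddCircle.haarAddCircle := by
  rw [integral_mul_norm_sq_inner_characterVector hf, fejerMean]
  congr 1
  refine Finset.sum_congr rfl fun k _ => Finset.sum_congr rfl fun h _ => ?_
  simp only [characterVector, ← fourier_neg, neg_neg]
  rw [sub_eq_add_neg, fourier_add]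
  ring

lemma norm_fejerMean_le (d : ℕ) {f : AddCircle T → ℂ}
    (hf : Integrable f AddCircle.haarAddCircle) (x : AddCircle T) :
    ‖fejerMean d f x‖ ≤ (fejerMean d (fun y => (‖f y‖ : ℂ)) x).re := by
  rw [fejerMean_eq_integral d hf, fejerMean_eq_integral d (f := fun y => (‖f y‖ : ℂ)) hf.norm.ofReal]
  simp_rw [← Complex.ofReal_mul]
  rw [integral_complex_ofReal, ← Complex.ofReal_natCast, ← Complex.ofReal_inv,
    ← Complex.ofReal_mul, Complex.ofReal_re, norm_mul, Complex.norm_real,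
    Real.norm_of_nonneg (by positivity)]
  gcongr
  refine (norm_integral_le_integral_norm _).trans_eq (integral_congr_ae (ae_of_all _ fun y => ?_))
  simp

lemma integral_fejerMean {d : ℕ} (hd : d ≠ 0) (f : AddCircle T → ℂ) :
    ∫ x, fejerMean d f x ∂AddCircle.haarAddCircle = ∫ x, f x ∂AddCircle.haarAddCircle := by
  have hterm : ∀ (c : ℂ) (n : ℤ), Integrable (fun x : AddCircle T => c * fourier n x)
      AddCircle.haarAddCircle := fun c n => integrable_of_continuous (by fun_prop)
  simp only [fejerMean]
  rw [integral_const_mul, integral_finsetSum _ fun k _ => integrable_finsetSum _ fun h _ => hterm _ _]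
  simp_rw [integral_finsetSum _ fun h _ => hterm _ _, integral_const_mul, integral_fourier,
    sub_eq_zero, Nat.cast_inj, Fin.val_inj]
  simp only [mul_ite, mul_one, mul_zero, Finset.sum_ite_eq, Finset.mem_univ, if_true, sub_self,
    Finset.sum_const, Finset.card_univ, Fintype.card_fin, nsmul_eq_mul]
  rw [inv_mul_cancel_left₀ (by exact_mod_cast hd)]
  simp only [fourierCoeff, neg_zero, fourier_zero, one_smul]

lemma integral_norm_fejerMean_le (d : ℕ) {f : AddCircle T → ℂ}
    (hf : Integrable f AddCircle.haarAddCircle) :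
    ∫ x, ‖fejerMean d f x‖ ∂AddCircle.haarAddCircle ≤ ∫ x, ‖f x‖ ∂AddCircle.haarAddCircle := by
  rcases eq_or_ne d 0 with rfl | hd
  · simp only [fejerMean, Nat.cast_zero, inv_zero, zero_mul, norm_zero, integral_zero]
    positivity
  have hint : ∀ f : AddCircle T → ℂ, Integrable (fejerMean d f) AddCircle.haarAddCircle :=
    fun f => integrable_of_continuous (continuous_fejerMean d f)
  calc _ ≤ ∫ x, (fejerMean d (fun y => (‖f y‖ : ℂ)) x).re ∂AddCircle.haarAddCircle :=
        integral_mono (hint f).norm (hint _).re (norm_fejerMean_le d hf)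
    _ = (∫ x, fejerMean d (fun y => (‖f y‖ : ℂ)) x ∂AddCircle.haarAddCircle).re :=
        integral_re (hint _)
    _ = _ := by rw [integral_fejerMean hd, integral_complex_ofReal, Complex.ofReal_re]

lemma fejerMean_fourier (d : ℕ) (n : ℤ) (x : AddCircle T) :
    fejerMean d (fourier n) x =
      (d : ℂ)⁻¹ * (∑ h : Fin d, ∑ k : Fin d,
        if ((h : ℕ) : ℤ) - ((k : ℕ) : ℤ) = n then 1 else 0) * fourier n x := by
  simp only [fejerMean, fourierCoeff_fourier, Finset.mul_sum, Finset.sum_mul]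
  refine Finset.sum_congr rfl fun h _ => Finset.sum_congr rfl fun k _ => ?_
  rw [Pi.single_apply]
  split_ifs with hn
  · rw [hn]; ring
  · simp

lemma sum_ite_sub_eq_mem_Icc (d : ℕ) (n : ℤ) :
    (∑ h : Fin d, ∑ k : Fin d, if ((h : ℕ) : ℤ) - ((k : ℕ) : ℤ) = n then (1 : ℝ) else 0) ∈
      Set.Icc ((d : ℝ) - |n|) d := by
  have hrow : ∀ h : Fin d,
      (∑ k : Fin d, if ((h : ℕ) : ℤ) - ((k : ℕ) : ℤ) = n then (1 : ℝ) else 0) =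
        1 - if ((h : ℕ) : ℤ) - n ∈ Set.Ico 0 (d : ℤ) then 0 else 1 := by
    intro h
    split_ifs with hh
    · rw [Finset.sum_eq_single ⟨(((h : ℕ) : ℤ) - n).toNat, by have := hh.1; have := hh.2; omega⟩]
      · rw [if_pos (by have := hh.1; simp; omega), sub_zero]
      · intro k _ hk
        rw [if_neg]
        intro h'
        apply hk
        ext
        simp
        omega
      · simp
    · rw [sub_self]
      refine Finset.sum_eq_zero fun k _ => if_neg fun h' => hh ⟨?_, ?_⟩ <;> omega
  simp_rw [hrow, Finset.sum_sub_distrib]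
  have hcard : (∑ h : Fin d, if ((h : ℕ) : ℤ) - n ∈ Set.Ico 0 (d : ℤ) then (0 : ℝ) else 1) ≤
      |n| := by
    rw [Fin.sum_univ_eq_sum_range
      (fun h => if ((h : ℕ) : ℤ) - n ∈ Set.Ico 0 (d : ℤ) then (0 : ℝ) else 1)]
    have hsub : (Finset.range d).filter (fun h : ℕ => ¬ ((h : ℤ) - n ∈ Set.Ico 0 (d : ℤ))) ⊆
        Finset.range n.toNat ∪ Finset.Ico (d - (-n).toNat) d := by
      intro h hh
      simp only [Finset.mem_filter, Finset.mem_range, Set.mem_Ico, not_and_or, not_le, not_lt,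
        Finset.mem_union, Finset.mem_Ico] at hh ⊢
      omega
    have hle : ((Finset.range d).filter
        (fun h : ℕ => ¬ ((h : ℤ) - n ∈ Set.Ico 0 (d : ℤ)))).card ≤ n.natAbs := by
      refine (Finset.card_le_card hsub).trans ((Finset.card_union_le _ _).trans ?_)
      simp only [Finset.card_range, Nat.card_Ico]
      omega
    have heq : (∑ h ∈ Finset.range d,
        if ((h : ℕ) : ℤ) - n ∈ Set.Ico 0 (d : ℤ) then (0 : ℝ) else 1) = ((Finset.range d).filter
        (fun h : ℕ => ¬ ((h : ℤ) - n ∈ Set.Ico 0 (d : ℤ)))).card := by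
      rw [Finset.card_filter]
      push_cast
      refine Finset.sum_congr rfl fun h _ => ?_
      split_ifs <;> simp_all
    rw [heq, ← Nat.cast_natAbs]
    exact_mod_cast hle
  have hnonneg : 0 ≤ ∑ h : Fin d, if ((h : ℕ) : ℤ) - n ∈ Set.Ico 0 (d : ℤ) then (0 : ℝ) else 1 :=
    Finset.sum_nonneg fun _ _ => by split_ifs <;> norm_num
  simp only [Finset.sum_const, Finset.card_univ, Fintype.card_fin, nsmul_eq_mul, mul_one]
  rw [Int.cast_abs] at hcard ⊢
  constructor <;> linarith

lemma tendsto_integral_norm_fejerMean_fourier_sub (n : ℤ) :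
    Tendsto (fun d : ℕ => ∫ x : AddCircle T, ‖fejerMean d (fourier n) x - fourier n x‖
      ∂AddCircle.haarAddCircle) atTop (nhds 0) := by
  have hlim : Tendsto (fun d : ℕ => (|n| : ℝ) / d) atTop (nhds 0) :=
    tendsto_const_div_atTop_nhds_zero_nat _
  refine squeeze_zero' (Eventually.of_forall fun d => by positivity) ?_ hlim
  filter_upwards [eventually_gt_atTop 0] with d hd
  have hd' : (0 : ℝ) < d := by exact_mod_cast hd
  obtain ⟨hl, hu⟩ := sum_ite_sub_eq_mem_Icc d n
  set N := ∑ h : Fin d, ∑ k : Fin d, if ((h : ℕ) : ℤ) - ((k : ℕ) : ℤ) = n then (1 : ℝ) else 0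
    with hN
  have hNc : (∑ h : Fin d, ∑ k : Fin d,
      if ((h : ℕ) : ℤ) - ((k : ℕ) : ℤ) = n then (1 : ℂ) else 0) = (N : ℂ) := by
    simp [hN]
  have hpt : ∀ x : AddCircle T, ‖fejerMean d (fourier n) x - fourier n x‖ = 1 - N / d := by
    intro x
    rw [fejerMean_fourier, hNc, ← sub_one_mul, norm_mul, norm_fourier_apply, mul_one, norm_sub_rev,
      ← Complex.ofReal_natCast, ← Complex.ofReal_inv, ← Complex.ofReal_mul, ← Complex.ofReal_one,
      ← Complex.ofReal_sub, Complex.norm_real, Real.norm_of_nonneg]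
    · ring
    · rw [inv_mul_eq_div, sub_nonneg, div_le_one hd']
      exact hu
  simp only [hpt, integral_const, probReal_univ, one_smul]
  rw [sub_le_iff_le_add, ← add_div, le_div_iff₀ hd']
  push_cast at hl
  linarith

lemma tendsto_integral_norm_fejerMean_sub_of_mem_span {q : C(AddCircle T, ℂ)}
    (hq : q ∈ Submodule.span ℂ (Set.range (fourier (T := T)))) :
    Tendsto (fun d : ℕ => ∫ x : AddCircle T, ‖fejerMean d q x - q x‖
      ∂AddCircle.haarAddCircle) atTop (nhds 0) := by
  have hint : ∀ q : C(AddCircle T, ℂ), Integrable q AddCircle.haarAddCircle :=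
    fun q => integrable_of_continuous q.continuous
  have hsub : ∀ (d : ℕ) (q : C(AddCircle T, ℂ)),
      Integrable (fun x => ‖fejerMean d q x - q x‖) AddCircle.haarAddCircle := fun d q =>
    (integrable_of_continuous ((continuous_fejerMean d q).sub q.continuous)).norm
  induction hq using Submodule.span_induction with
  | mem q hq =>
    obtain ⟨n, rfl⟩ := hq
    exact tendsto_integral_norm_fejerMean_fourier_sub n
  | zero =>
    refine tendsto_const_nhds.congr fun d => ?_
    simp [fejerMean, fourierCoeff]
  | add p q _ _ hp hq =>
    refine squeeze_zero (fun d => by positivity) (fun d => ?_) (by simpa using hp.add hq)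
    rw [← integral_add (hsub d p) (hsub d q)]
    refine integral_mono (hsub d (p + q)) ((hsub d p).add (hsub d q)) fun x => ?_
    simp only [ContinuousMap.coe_add, fejerMean_add d (hint p) (hint q), Pi.add_apply]
    rw [add_sub_add_comm]
    exact norm_add_le _ _
  | smul c q _ hq =>
    refine (by simpa using hq.const_mul ‖c‖ : Tendsto _ _ (nhds (0 : ℝ))).congr fun d => ?_
    rw [← integral_const_mul]
    refine integral_congr_ae (ae_of_all _ fun x => ?_)
    simp only [ContinuousMap.coe_smul, fejerMean_smul, Pi.smul_apply, smul_eq_mul]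
    rw [← mul_sub, norm_mul]

/-- Fejér means converge in `L¹`. -/
theorem tendsto_integral_norm_fejerMean_sub {f : AddCircle T → ℂ}
    (hf : Integrable f AddCircle.haarAddCircle) :
    Tendsto (fun d : ℕ => ∫ x : AddCircle T, ‖fejerMean d f x - f x‖
      ∂AddCircle.haarAddCircle) atTop (nhds 0) := by
  rw [Metric.tendsto_atTop']
  intro ε hε
  obtain ⟨k, hk, -⟩ := hf.exists_boundedContinuous_integral_sub_le (ε := ε / 6) (by positivity)
  have hcl : k.toContinuousMap ∈
      (Submodule.span ℂ (Set.range (fourier (T := T)))).topologicalClosure := by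
    rw [span_fourier_closure_eq_top]; trivial
  obtain ⟨q, hq, hkq⟩ := Metric.mem_closure_iff.mp hcl (ε / 6) (by positivity)
  have hkint : Integrable k AddCircle.haarAddCircle := integrable_of_continuous k.continuous
  have hqint : Integrable q AddCircle.haarAddCircle := integrable_of_continuous q.continuous
  have hfq : ∫ x, ‖f x - q x‖ ∂AddCircle.haarAddCircle ≤ ε / 3 := by
    calc _ ≤ ∫ x, (‖f x - k x‖ + ε / 6) ∂AddCircle.haarAddCircle := by
          refine integral_mono (hf.sub hqint).norm
            ((hf.sub hkint).norm.add (integrable_const _)) fun x => ?_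
          have h1 : ‖k x - q x‖ ≤ ε / 6 := by
            rw [← dist_eq_norm]
            exact (ContinuousMap.dist_apply_le_dist (f := k.toContinuousMap) x).trans hkq.le
          calc _ ≤ ‖f x - k x‖ + ‖k x - q x‖ := norm_sub_le_norm_sub_add_norm_sub _ _ _
            _ ≤ _ := by gcongr
      _ = (∫ x, ‖f x - k x‖ ∂AddCircle.haarAddCircle) + ε / 6 := by
          rw [integral_add (by exact (hf.sub hkint).norm) (integrable_const _)]
          simp
      _ ≤ ε / 3 := by linarith
  obtain ⟨N, hN⟩ := Metric.tendsto_atTop'.mp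
    (tendsto_integral_norm_fejerMean_sub_of_mem_span hq) (ε / 3) (by positivity)
  refine ⟨N, fun d hd => ?_⟩
  have hdq := hN d hd
  rw [Real.dist_0_eq_abs, abs_of_nonneg (by positivity)] at hdq ⊢
  have hcont := integral_norm_fejerMean_le d (hf.sub hqint)
  have hi1 : Integrable (fun x => ‖fejerMean d (f - ⇑q) x‖) AddCircle.haarAddCircle :=
    (integrable_of_continuous (continuous_fejerMean d _)).norm
  have hi2 : Integrable (fun x => ‖fejerMean d q x - q x‖) AddCircle.haarAddCircle :=
    (integrable_of_continuous ((continuous_fejerMean d q).sub q.continuous)).norm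
  have hi3 : Integrable (fun x => ‖f x - q x‖) AddCircle.haarAddCircle := (hf.sub hqint).norm
  have htri : ∫ x, ‖fejerMean d f x - f x‖ ∂AddCircle.haarAddCircle ≤
      (∫ x, ‖fejerMean d (f - ⇑q) x‖ ∂AddCircle.haarAddCircle) +
        (∫ x, ‖fejerMean d q x - q x‖ ∂AddCircle.haarAddCircle) +
        ∫ x, ‖f x - q x‖ ∂AddCircle.haarAddCircle := by
    rw [← integral_add hi1 hi2, ← integral_add (by exact hi1.add hi2) hi3]
    refine integral_mono
      ((integrable_of_continuous (continuous_fejerMean d f)).sub hf).norm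
      ((hi1.add hi2).add hi3) fun x => ?_
    simp only
    rw [fejerMean_sub d hf hqint, norm_sub_rev (f x)]
    calc _ = ‖(fejerMean d f x - fejerMean d q x) + (fejerMean d q x - q x) + (q x - f x)‖ := by
          congr 1; ring
      _ ≤ _ := norm_add₃_le
  have hcont' : ∫ x, ‖(f - ⇑q) x‖ ∂AddCircle.haarAddCircle ≤ ε / 3 := hfq
  linarith

end Fejer

section Entropy

lemma mul_one_add_log_sub_le_mul_log {y c : ℝ} (hy : 0 ≤ y) (hc : 0 < c) :
    y * (1 + Real.log c) - c ≤ y * Real.log y := by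
  rcases hy.eq_or_lt with rfl | hy
  · simpa using hc.le
  have h := Real.log_le_sub_one_of_pos (div_pos hc hy)
  rw [Real.log_div hc.ne' hy.ne'] at h
  have h' := mul_le_mul_of_nonneg_left h hy.le
  have hcy : y * (c / y - 1) = c - y := by field_simp
  rw [hcy] at h'
  linarith

lemma integrable_mul_log {X : Type*} [MeasurableSpace X] {μ : Measure X} [IsFiniteMeasure μ]
    {g : X → ℝ} (hg0 : ∀ᵐ x ∂μ, 0 ≤ g x) (hgm : AEMeasurable g μ) {α : ℝ} (hα : 1 < α)
    (hint : Integrable (fun x => g x ^ α) μ) : Integrable (fun x => g x * Real.log (g x)) μ := by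
  refine ((integrable_const (1 : ℝ)).add (hint.div_const (α - 1))).mono'
    (hgm.mul (Real.measurable_log.comp_aemeasurable hgm)).aestronglyMeasurable ?_
  filter_upwards [hg0] with x hx
  have hα' : 0 < α - 1 := by linarith
  have hpow : 0 ≤ g x ^ α / (α - 1) := div_nonneg (Real.rpow_nonneg hx _) hα'.le
  simp only [Pi.add_apply]
  rw [Real.norm_eq_abs, abs_le]
  constructor
  · have := mul_one_add_log_sub_le_mul_log hx one_pos
    rw [Real.log_one] at this
    linarith
  · rcases hx.eq_or_lt with h0 | h0
    · rw [← h0] at hpow ⊢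
      simp only [zero_mul]
      linarith
    have h1 := mul_le_mul_of_nonneg_left (Real.log_le_rpow_div hx hα') hx
    have h2 : g x * (g x ^ (α - 1) / (α - 1)) = g x ^ α / (α - 1) := by
      rw [Real.rpow_sub_one h0.ne']
      field_simp
    linarith

/-- The truncation of `y` to the interval `[1 / (n + 1), n + 1]`. -/
noncomputable def truncation (n : ℕ) (y : ℝ) : ℝ := max (1 / ((n : ℝ) + 1)) (min y ((n : ℝ) + 1))

lemma one_div_le_truncation (n : ℕ) (y : ℝ) : 1 / ((n : ℝ) + 1) ≤ truncation n y := le_max_left _ _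

lemma truncation_pos (n : ℕ) (y : ℝ) : 0 < truncation n y :=
  lt_of_lt_of_le (by positivity) (one_div_le_truncation n y)

lemma truncation_le (n : ℕ) (y : ℝ) : truncation n y ≤ n + 1 := by
  refine max_le ?_ (min_le_right _ _)
  rw [div_le_iff₀ (by positivity)]
  have : (0 : ℝ) ≤ n := n.cast_nonneg
  nlinarith

lemma abs_log_truncation_le (n : ℕ) (y : ℝ) : |Real.log (truncation n y)| ≤ Real.log (n + 1) := by
  rw [abs_le]
  constructor
  · rw [← Real.log_inv, ← one_div]
    exact Real.log_le_log (by positivity) (one_div_le_truncation n y)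
  · exact Real.log_le_log (truncation_pos n y) (truncation_le n y)

lemma continuous_truncation (n : ℕ) : Continuous (truncation n) := by
  unfold truncation
  fun_prop

lemma truncation_le_add_one (n : ℕ) {y : ℝ} (hy : 0 ≤ y) : truncation n y ≤ y + 1 := by
  refine max_le ?_ ((min_le_left _ _).trans (by linarith))
  rw [div_le_iff₀ (by positivity)]
  have : (0 : ℝ) ≤ n := n.cast_nonneg
  nlinarith [mul_nonneg hy this]

lemma abs_log_truncation_le_abs_log (n : ℕ) {y : ℝ} (hy : 0 < y) :
    |Real.log (truncation n y)| ≤ |Real.log y| := by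
  have hn : (1 : ℝ) ≤ n + 1 := by linarith [(n.cast_nonneg : (0 : ℝ) ≤ n)]
  rcases le_total 1 y with h1 | h1
  · have h2 : 1 ≤ truncation n y := le_max_of_le_right (le_min h1 hn)
    have h3 : truncation n y ≤ y := max_le
      ((div_le_one (by positivity)).mpr hn |>.trans h1) (min_le_left _ _)
    rw [abs_of_nonneg (Real.log_nonneg h2), abs_of_nonneg (Real.log_nonneg h1)]
    exact Real.log_le_log (truncation_pos n y) h3
  · have h2 : truncation n y ≤ 1 := max_le ((div_le_one (by positivity)).mpr hn)
      ((min_le_left _ _).trans h1)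
    have h3 : y ≤ truncation n y := le_max_of_le_right (le_min le_rfl (h1.trans hn))
    rw [abs_of_nonpos (Real.log_nonpos (truncation_pos n y).le h2),
      abs_of_nonpos (Real.log_nonpos hy.le h1)]
    exact neg_le_neg (Real.log_le_log hy h3)

lemma tendsto_truncation {y : ℝ} (hy : 0 ≤ y) :
    Tendsto (fun n => truncation n y) atTop (nhds y) := by
  have h1 : Tendsto (fun n : ℕ => 1 / ((n : ℝ) + 1)) atTop (nhds 0) :=
    tendsto_one_div_add_atTop_nhds_zero_nat
  have h2 : Tendsto (fun n : ℕ => min y ((n : ℝ) + 1)) atTop (nhds y) := by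
    refine tendsto_const_nhds.congr' ?_
    filter_upwards [eventually_ge_atTop ⌈y⌉₊] with n hn
    exact (min_eq_left (by linarith [Nat.ceil_le.mp hn])).symm
  have := h1.max h2
  rwa [max_eq_right hy] at this

/-- The tangent-line minorants of `y log y` at truncations of `g` have integrals converging to
`∫ g log g`. -/
lemma tendsto_integral_mul_one_add_log_truncation {X : Type*} [MeasurableSpace X] {μ : Measure X}
    [IsFiniteMeasure μ] {g : X → ℝ} (hg0 : ∀ x, 0 ≤ g x) (hg : Integrable g μ)
    (hgl : Integrable (fun x => g x * Real.log (g x)) μ) :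
    Tendsto (fun n : ℕ => ∫ x, (g x * (1 + Real.log (truncation n (g x))) - truncation n (g x)) ∂μ)
      atTop (nhds (∫ x, g x * Real.log (g x) ∂μ)) := by
  refine tendsto_integral_of_dominated_convergence
    (fun x => 2 * g x + 1 + |g x * Real.log (g x)|) (fun n => ?_)
    (((hg.const_mul 2).add (integrable_const 1)).add hgl.abs) (fun n => ae_of_all _ fun x => ?_)
    (ae_of_all _ fun x => ?_)
  · have hgm := hg.aemeasurable
    have hc := (continuous_truncation n).measurable.comp_aemeasurable hgm
    exact ((hgm.mul ((Real.measurable_log.comp_aemeasurable hc).const_add 1)).sub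
      hc).aestronglyMeasurable
  · have hb : |g x * Real.log (truncation n (g x))| ≤ |g x * Real.log (g x)| := by
      rcases (hg0 x).eq_or_lt with h0 | h0
      · simp [← h0]
      · rw [abs_mul, abs_mul]
        exact mul_le_mul_of_nonneg_left (abs_log_truncation_le_abs_log n h0) (abs_nonneg _)
    have h1 := truncation_pos n (g x)
    have h2 := truncation_le_add_one n (hg0 x)
    have h3 := hg0 x
    rw [Real.norm_eq_abs, mul_add, mul_one]
    rw [abs_le] at hb ⊢
    constructor <;> linarith
  · have ht := tendsto_truncation (hg0 x)
    rcases (hg0 x).eq_or_lt with h0 | h0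
    · simp only [← h0, zero_mul] at ht ⊢
      simpa using ht.neg
    · have hl := (Real.continuousAt_log h0.ne').tendsto.comp ht
      have := ((hl.const_add 1).const_mul (g x)).sub ht
      rwa [show g x * (1 + Real.log (g x)) - g x = g x * Real.log (g x) by ring] at this

end Entropy

section Toeplitz

variable {T : ℝ} [Fact (0 < T)] {g : AddCircle T → ℝ} {d : ℕ} {A : Matrix (Fin d) (Fin d) ℂ}

lemma integral_mul_norm_sq_inner_eigenvectorBasis (hg : Integrable g AddCircle.haarAddCircle)
    (hA : ∀ h k, A h k =
      fourierCoeff (fun x => (g x : ℂ)) (((h : ℕ) : ℤ) - ((k : ℕ) : ℤ)))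
    (hH : A.IsHermitian) (j : Fin d) :
    ∫ x, g x * ‖inner ℂ (hH.eigenvectorBasis j) (characterVector d x)‖ ^ 2
      ∂AddCircle.haarAddCircle = hH.eigenvalues j := by
  have h := integral_mul_norm_sq_inner_characterVector (f := fun x => (g x : ℂ)) hg.ofReal
    (hH.eigenvectorBasis j)
  simp_rw [← hA, hH.sum_conj_mul_eigenvectorBasis, ← Complex.ofReal_mul,
    integral_complex_ofReal] at h
  exact_mod_cast h

lemma sum_eigenvalues_mul_norm_sq_inner_characterVector (hd : d ≠ 0)
    (hA : ∀ h k, A h k =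
      fourierCoeff (fun x => (g x : ℂ)) (((h : ℕ) : ℤ) - ((k : ℕ) : ℤ)))
    (hH : A.IsHermitian) (x : AddCircle T) :
    ∑ j, hH.eigenvalues j * ‖inner ℂ (hH.eigenvectorBasis j) (characterVector d x)‖ ^ 2 =
      d * (fejerMean d (fun x => (g x : ℂ)) x).re := by
  have h := hH.sum_eigenvalues_mul_norm_sq_inner (characterVector d x)
  have h' : ∑ h, ∑ k, starRingEnd ℂ (characterVector d x h) * (A h k * characterVector d x k) =
      ((d : ℝ) : ℂ) * fejerMean d (fun x => (g x : ℂ)) x := by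
    rw [fejerMean, Complex.ofReal_natCast, mul_inv_cancel_left₀ (by exact_mod_cast hd)]
    refine Finset.sum_congr rfl fun h _ => Finset.sum_congr rfl fun k _ => ?_
    simp only [characterVector, ← fourier_neg, neg_neg, hA]
    rw [sub_eq_add_neg, fourier_add]
    ring
  rw [h'] at h
  have := congrArg Complex.re h
  rwa [Complex.ofReal_re, Complex.re_ofReal_mul] at this

lemma sum_eigenvalues_mul_log_le (hg0 : ∀ x, 0 ≤ g x) (hg : Integrable g AddCircle.haarAddCircle)
    (hgl : Integrable (fun x => g x * Real.log (g x)) AddCircle.haarAddCircle)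
    (hA : ∀ h k, A h k =
      fourierCoeff (fun x => (g x : ℂ)) (((h : ℕ) : ℤ) - ((k : ℕ) : ℤ)))
    (hPSD : A.PosSemidef) :
    ∑ j, hPSD.isHermitian.eigenvalues j * Real.log (hPSD.isHermitian.eigenvalues j) ≤
      d * ∫ x, g x * Real.log (g x) ∂AddCircle.haarAddCircle := by
  set b := hPSD.isHermitian.eigenvectorBasis
  have hsum : ∑ j, ∫ x, (g x * Real.log (g x)) * ‖inner ℂ (b j) (characterVector d x)‖ ^ 2
      ∂AddCircle.haarAddCircle = d * ∫ x, g x * Real.log (g x) ∂AddCircle.haarAddCircle := by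
    rw [← integral_finsetSum _ fun j _ => hgl.mul_norm_sq_inner_characterVector (b j),
      ← integral_const_mul]
    refine integral_congr_ae (ae_of_all _ fun x => ?_)
    simp only
    rw [← Finset.mul_sum, b.sum_sq_norm_inner_right, norm_sq_characterVector, mul_comm]
  rw [← hsum]
  refine Finset.sum_le_sum fun j _ => ?_
  have htangent : ∀ c : ℝ, 0 < c → hPSD.isHermitian.eigenvalues j * (1 + Real.log c) - c ≤
      ∫ x, (g x * Real.log (g x)) * ‖inner ℂ (b j) (characterVector d x)‖ ^ 2
        ∂AddCircle.haarAddCircle := by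
    intro c hc
    have hi1 := hg.mul_norm_sq_inner_characterVector (b j)
    have hi2 : Integrable (fun x : AddCircle T => ‖inner ℂ (b j) (characterVector d x)‖ ^ 2)
        AddCircle.haarAddCircle := by
      simpa using (integrable_const (1 : ℝ)).mul_norm_sq_inner_characterVector (b j)
    have hval : ∫ x, (g x * ‖inner ℂ (b j) (characterVector d x)‖ ^ 2 * (1 + Real.log c) -
        c * ‖inner ℂ (b j) (characterVector d x)‖ ^ 2) ∂AddCircle.haarAddCircle =
        hPSD.isHermitian.eigenvalues j * (1 + Real.log c) - c := by
      rw [integral_sub (hi1.mul_const _) (hi2.const_mul _), integral_mul_const,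
        integral_const_mul, integral_mul_norm_sq_inner_eigenvectorBasis hg hA,
        integral_norm_sq_inner_characterVector, b.norm_eq_one]
      ring
    rw [← hval]
    refine integral_mono ((hi1.mul_const _).sub (hi2.const_mul _))
      (hgl.mul_norm_sq_inner_characterVector (b j)) fun x => ?_
    have := mul_le_mul_of_nonneg_right (mul_one_add_log_sub_le_mul_log (hg0 x) hc)
      (sq_nonneg ‖inner ℂ (b j) (characterVector d x)‖)
    simp only
    linarith
  rcases (hPSD.eigenvalues_nonneg j).eq_or_lt with h0 | h0
  · rw [← h0] at htangent ⊢
    rw [zero_mul]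
    refine le_of_forall_pos_sub_le fun c hc => ?_
    simpa using htangent c hc
  · have := htangent _ h0
    linarith

lemma integral_tangent_sub_le_sum_eigenvalues_mul_log (hd : d ≠ 0)
    (hg : Integrable g AddCircle.haarAddCircle)
    (hA : ∀ h k, A h k =
      fourierCoeff (fun x => (g x : ℂ)) (((h : ℕ) : ℤ) - ((k : ℕ) : ℤ)))
    (hPSD : A.PosSemidef) (n : ℕ) :
    (∫ x, (g x * (1 + Real.log (truncation n (g x))) - truncation n (g x))
        ∂AddCircle.haarAddCircle) -
      (1 + Real.log (n + 1)) * ∫ x, ‖fejerMean d (fun x => (g x : ℂ)) x - g x‖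
        ∂AddCircle.haarAddCircle ≤
    (1 / (d : ℝ)) *
      ∑ j, hPSD.isHermitian.eigenvalues j * Real.log (hPSD.isHermitian.eigenvalues j) := by
  set b := hPSD.isHermitian.eigenvectorBasis
  have hd' : (0 : ℝ) < d := by positivity
  set w : Fin d → AddCircle T → ℝ := fun j x => ‖inner ℂ (b j) (characterVector d x)‖ ^ 2 with hw
  have hwi : ∀ j, Integrable (w j) AddCircle.haarAddCircle := fun j => by
    simpa using (integrable_const (1 : ℝ)).mul_norm_sq_inner_characterVector (b j)
  have hwint : ∀ j, ∫ x, w j x ∂AddCircle.haarAddCircle = 1 := fun j => by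
    rw [hw]
    simp only
    rw [integral_norm_sq_inner_characterVector, b.norm_eq_one, one_pow]
  have hsum : (1 / (d : ℝ)) *
      ∑ j, hPSD.isHermitian.eigenvalues j * Real.log (hPSD.isHermitian.eigenvalues j) =
      ∫ x, (1 / (d : ℝ)) * ∑ j, hPSD.isHermitian.eigenvalues j *
        Real.log (hPSD.isHermitian.eigenvalues j) * w j x ∂AddCircle.haarAddCircle := by
    rw [integral_const_mul, integral_finsetSum _ fun j _ => (hwi j).const_mul _]
    simp only [integral_const_mul, hwint, mul_one]
  have hgm := hg.aemeasurable
  have hcm : AEMeasurable (fun x => truncation n (g x)) AddCircle.haarAddCircle :=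
    (continuous_truncation n).measurable.comp_aemeasurable hgm
  have hlm : AEMeasurable (fun x => 1 + Real.log (truncation n (g x))) AddCircle.haarAddCircle :=
    (Real.measurable_log.comp_aemeasurable hcm).const_add 1
  have hlb : ∀ y, ‖1 + Real.log (truncation n y)‖ ≤ 1 + Real.log (n + 1) := fun y => by
    refine (norm_add_le _ _).trans ?_
    rw [norm_one, Real.norm_eq_abs]
    gcongr
    exact abs_log_truncation_le n y
  have hci : Integrable (fun x => truncation n (g x)) AddCircle.haarAddCircle :=
    (integrable_const ((n : ℝ) + 1)).mono' hcm.aestronglyMeasurable (ae_of_all _ fun x => by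
      rw [Real.norm_of_nonneg (truncation_pos n _).le]; exact truncation_le n _)
  have hgi : Integrable (fun x => g x * (1 + Real.log (truncation n (g x))))
      AddCircle.haarAddCircle :=
    hg.mul_bdd hlm.aestronglyMeasurable (ae_of_all _ fun x => hlb (g x))
  have herr : Integrable (fun x => ‖fejerMean d (fun x => (g x : ℂ)) x - g x‖)
      AddCircle.haarAddCircle :=
    ((integrable_of_continuous (continuous_fejerMean d _)).sub hg.ofReal).norm
  rw [hsum, ← integral_const_mul, ← integral_sub (by exact hgi.sub hci) (herr.const_mul _)]
  refine integral_mono ((hgi.sub hci).sub (herr.const_mul _))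
    ((integrable_finsetSum _ fun j _ => (hwi j).const_mul _).const_mul _) fun x => ?_
  set c := truncation n (g x) with hc
  set s := fejerMean d (fun x => (g x : ℂ)) x with hs
  have hre : |s.re - g x| ≤ ‖s - g x‖ := by
    simpa using Complex.abs_re_le_norm (s - g x)
  have hlow : (1 + Real.log c) * s.re - c ≤ (1 / (d : ℝ)) * ∑ j, hPSD.isHermitian.eigenvalues j *
        Real.log (hPSD.isHermitian.eigenvalues j) * w j x := by
    have h1 : ∑ j, (hPSD.isHermitian.eigenvalues j * (1 + Real.log c) - c) * w j x =
        d * ((1 + Real.log c) * s.re - c) := by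
      have e1 := sum_eigenvalues_mul_norm_sq_inner_characterVector hd hA hPSD.isHermitian x
      have e2 : ∑ j, w j x = d := by
        rw [hw]; simp only; rw [b.sum_sq_norm_inner_right, norm_sq_characterVector]
      calc _ = (1 + Real.log c) * ∑ j, hPSD.isHermitian.eigenvalues j * w j x
            - c * ∑ j, w j x := by
            rw [Finset.mul_sum, Finset.mul_sum, ← Finset.sum_sub_distrib]
            exact Finset.sum_congr rfl fun j _ => by ring
        _ = _ := by rw [e1, e2]; ring
    rw [one_div, inv_mul_eq_div, le_div_iff₀ hd', mul_comm, ← h1]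
    exact Finset.sum_le_sum fun j _ => mul_le_mul_of_nonneg_right
      (mul_one_add_log_sub_le_mul_log (hPSD.eigenvalues_nonneg j) (truncation_pos n _))
      (sq_nonneg _)
  refine le_trans ?_ hlow
  have h2 : |(1 + Real.log c) * (s.re - g x)| ≤ (1 + Real.log (n + 1)) * ‖s - g x‖ := by
    rw [abs_mul]
    exact mul_le_mul (hlb (g x)) hre (abs_nonneg _) ((norm_nonneg _).trans (hlb (g x)))
  have h3 := (abs_le.mp h2).1
  simp only
  linarith

/-- Szegő's limit theorem for the eigenvalue functional `t ↦ t log t`. -/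
theorem tendsto_sum_eigenvalues_mul_log (hg0 : ∀ x, 0 ≤ g x)
    (hg : Integrable g AddCircle.haarAddCircle)
    (hgl : Integrable (fun x => g x * Real.log (g x)) AddCircle.haarAddCircle)
    {A : (d : ℕ) → Matrix (Fin d) (Fin d) ℂ}
    (hA : ∀ d h k, A d h k =
      fourierCoeff (fun x => (g x : ℂ)) (((h : ℕ) : ℤ) - ((k : ℕ) : ℤ)))
    (hPSD : ∀ d, (A d).PosSemidef) :
    Tendsto (fun d : ℕ => (1 / (d : ℝ)) * ∑ j : Fin d,
        (hPSD d).isHermitian.eigenvalues j * Real.log ((hPSD d).isHermitian.eigenvalues j))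
      atTop (nhds (∫ x, g x * Real.log (g x) ∂AddCircle.haarAddCircle)) := by
  refine tendsto_order.mpr ⟨fun a ha => ?_, fun a ha => ?_⟩
  · obtain ⟨n, hn⟩ :=
      ((tendsto_integral_mul_one_add_log_truncation hg0 hg hgl).eventually_const_lt ha).exists
    have herr := ((tendsto_integral_norm_fejerMean_sub (f := fun x => (g x : ℂ))
      hg.ofReal).const_mul (1 + Real.log (n + 1))).const_sub
      (∫ x, (g x * (1 + Real.log (truncation n (g x))) - truncation n (g x))
        ∂AddCircle.haarAddCircle)
    rw [mul_zero, sub_zero] at herr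
    filter_upwards [herr.eventually_const_lt hn, eventually_ne_atTop 0] with d hd hd0
    exact hd.trans_le
      (integral_tangent_sub_le_sum_eigenvalues_mul_log hd0 hg (hA d) (hPSD d) n)
  · filter_upwards [eventually_gt_atTop 0] with d hd
    have hd' : (0 : ℝ) < d := by exact_mod_cast hd
    refine lt_of_le_of_lt ?_ ha
    rw [one_div, inv_mul_eq_div, div_le_iff₀ hd', mul_comm]
    exact sum_eigenvalues_mul_log_le hg0 hg hgl (hA d) (hPSD d)

end Toeplitz

section Lift

variable {T : ℝ} [Fact (0 < T)]

lemma integral_haarAddCircle_liftIoc {E : Type*} [NormedAddCommGroup E] [NormedSpace ℝ E] (a : ℝ)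
    (f : ℝ → E) : ∫ x, AddCircle.liftIoc T a f x ∂AddCircle.haarAddCircle =
      T⁻¹ • ∫ x in a..a + T, f x := by
  rw [AddCircle.integral_haarAddCircle, AddCircle.integral_liftIoc_eq_intervalIntegral]

lemma integrable_liftIoc {a : ℝ} {f : ℝ → ℝ} (hf : IntegrableOn f (Set.Ioc a (a + T))) :
    Integrable (AddCircle.liftIoc T a f) AddCircle.haarAddCircle := by
  have h : MemLp (AddCircle.liftIoc T a fun x => (f x : ℂ)) 1 AddCircle.haarAddCircle :=
    memLp_haarAddCircle_iff.mpr (MemLp.memLp_liftIoc (memLp_one_iff_integrable.mpr hf.ofReal))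
  exact (memLp_one_iff_integrable.mp h).re

end Lift

/-- For a probability density `p` on `[-π, π]` with some finite Rényi entropy
of order `α₀ > 1`, the normalized sums `(1/d) Σ_j λ_j log₂ λ_j` over the eigenvalues of
the Toeplitz matrices `T_p⁽ᵈ⁾` converge to `∫ p log₂(2πp) dφ = log₂(2π) − h(p)`, where
`h(p)` is the differential entropy of `p`. -/
theorem szego_limit_eigenvalue_entropy
    (p : ℝ → ℝ) (hp_meas : Measurable p)
    (hp_nonneg : ∀ φ ∈ Set.Icc (-π) π, 0 ≤ p φ)
    (hp_prob : ∫ φ in (-π)..π, p φ = 1)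
    (α₀ : ℝ) (hα₀ : 1 < α₀)
    (hp_int : IntegrableOn (fun φ => p φ ^ α₀) (Set.Icc (-π) π))
    (T : (d : ℕ) → Matrix (Fin d) (Fin d) ℂ)
    (hT : ∀ (d : ℕ) (h k : Fin d),
      T d h k =
        ∫ φ in (-π)..π, (p φ : ℂ) * Complex.exp (-Complex.I * (((h : ℕ) : ℂ) - ((k : ℕ) : ℂ)) * φ))
    (hPSD : ∀ d : ℕ, (T d).PosSemidef) :
    Tendsto (fun d : ℕ =>
        (1 / (d : ℝ)) * ∑ j : Fin d,
          (hPSD d).isHermitian.eigenvalues j * Real.logb 2 ((hPSD d).isHermitian.eigenvalues j))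
      atTop (nhds (∫ φ in (-π)..π, p φ * Real.logb 2 (2 * π * p φ))) ∧
    (∫ φ in (-π)..π, p φ * Real.logb 2 (2 * π * p φ)) =
      Real.logb 2 (2 * π) - (-∫ φ in (-π)..π, p φ * Real.logb 2 (p φ)) := by
  have hT0 : Fact (0 < 2 * π) := ⟨Real.two_pi_pos⟩
  have hle : -π ≤ π := by linarith [Real.pi_pos]
  have hend : -π + 2 * π = π := by ring
  have hpi : (0 : ℝ) < 2 * π := Real.two_pi_pos
  have h0 : ∀ᵐ φ ∂(volume.restrict (Set.Ioc (-π) π)), 0 ≤ p φ :=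
    (ae_restrict_mem measurableSet_Ioc).mono fun φ hφ => hp_nonneg φ (Set.Ioc_subset_Icc_self hφ)
  have hpint : IntegrableOn p (Set.Ioc (-π) π) := by
    rw [intervalIntegral.integral_of_le hle] at hp_prob
    by_contra h
    rw [integral_undef h] at hp_prob
    exact zero_ne_one hp_prob
  have hplog : IntegrableOn (fun φ => p φ * Real.log (p φ)) (Set.Ioc (-π) π) :=
    integrable_mul_log h0 hp_meas.aemeasurable hα₀ (hp_int.mono_set Set.Ioc_subset_Icc_self)
  have hexpand : ∀ φ, p φ * Real.log (2 * π * p φ) =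
      Real.log (2 * π) * p φ + p φ * Real.log (p φ) := by
    intro φ
    rcases eq_or_ne (p φ) 0 with h | h
    · simp [h]
    · rw [Real.log_mul hpi.ne' h]
      ring
  have hqlog : IntegrableOn (fun φ => p φ * Real.log (2 * π * p φ)) (Set.Ioc (-π) π) := by
    simp_rw [hexpand]
    exact (hpint.const_mul _).add hplog
  have hlogb : ∀ φ, p φ * Real.logb 2 (2 * π * p φ) =
      (p φ * Real.log (2 * π * p φ)) / Real.log 2 := fun φ => by
    rw [Real.logb, mul_div_assoc]
  constructor
  · set g : AddCircle (2 * π) → ℝ := AddCircle.liftIoc (2 * π) (-π) fun φ => 2 * π * p φ with hg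
    have hgcoe : ∀ φ ∈ Set.Ioc (-π) (-π + 2 * π), g φ = 2 * π * p φ := fun φ hφ =>
      AddCircle.liftIoc_coe_apply hφ
    have hg0 : ∀ x, 0 ≤ g x := fun x => by
      have hx := (AddCircle.equivIoc (2 * π) (-π) x).2
      exact mul_nonneg hpi.le (hp_nonneg _ ⟨hx.1.le, hx.2.trans_eq hend⟩)
    have hgi : Integrable g AddCircle.haarAddCircle :=
      integrable_liftIoc (by rw [hend]; exact hpint.const_mul _)
    have hglog : (fun x => g x * Real.log (g x)) = AddCircle.liftIoc (2 * π) (-π)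
        fun φ => 2 * π * (p φ * Real.log (2 * π * p φ)) := by
      funext x
      simp only [hg, AddCircle.liftIoc, Function.comp_apply, Set.domRestrict_apply]
      ring
    have hgli : Integrable (fun x => g x * Real.log (g x)) AddCircle.haarAddCircle := by
      rw [hglog]
      exact integrable_liftIoc (by rw [hend]; exact hqlog.const_mul _)
    have hA : ∀ d h k, T d h k =
        fourierCoeff (fun x => (g x : ℂ)) (((h : ℕ) : ℤ) - ((k : ℕ) : ℤ)) := by
      intro d h k
      rw [hT, fourierCoeff_eq_intervalIntegral _ _ (-π), ← intervalIntegral.integral_smul, hend,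
        intervalIntegral.integral_of_le hle, intervalIntegral.integral_of_le hle]
      refine setIntegral_congr_fun measurableSet_Ioc fun φ hφ => ?_
      simp only [fourier_coe_apply, hgcoe φ ⟨hφ.1, hφ.2.trans_eq hend.symm⟩, smul_eq_mul, Complex.real_smul]
      have hpi' : (π : ℂ) ≠ 0 := by exact_mod_cast Real.pi_ne_zero
      have hexp : 2 * (π : ℂ) * Complex.I * ((-(((h : ℕ) : ℤ) - ((k : ℕ) : ℤ)) : ℤ) : ℂ) * φ /
          ((2 * π : ℝ) : ℂ) = -Complex.I * (((h : ℕ) : ℂ) - ((k : ℕ) : ℂ)) * φ := by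
        push_cast
        field_simp
      rw [hexp]
      push_cast
      field_simp
    have hlim := (tendsto_sum_eigenvalues_mul_log hg0 hgi hgli hA hPSD).div_const (Real.log 2)
    convert hlim using 2 with d
    · rw [mul_div_assoc, Finset.sum_div]
      simp only [Real.logb, mul_div_assoc]
    · rw [hglog, integral_haarAddCircle_liftIoc, hend, intervalIntegral.integral_const_mul,
        smul_eq_mul, inv_mul_cancel_left₀ hpi.ne', ← intervalIntegral.integral_div]
      simp only [hlogb]
  · have hi1 : IntervalIntegrable p volume (-π) π :=
      (intervalIntegrable_iff_integrableOn_Ioc_of_le hle).mpr hpint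
    have hi2 : IntervalIntegrable (fun φ => p φ * Real.log (p φ)) volume (-π) π :=
      (intervalIntegrable_iff_integrableOn_Ioc_of_le hle).mpr hplog
    simp only [hexpand, Real.logb, ← mul_div_assoc, intervalIntegral.integral_div]
    rw [intervalIntegral.integral_add (hi1.const_mul _) hi2, intervalIntegral.integral_const_mul,
      hp_prob]
    ring
end

section
/- Let κ > 0. Then for every φ ∈ [-π, π], the wrapped Cauchy series admits the closed form Σ_{k=-∞}^{+∞} √κ / ( π (κ + (φ + 2πk)²) ) = (1/2π) · sinh(√κ) / ( cosh(√κ) − cos φ ). -/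
open scoped Real

/-- The imaginary part of the cotangent at a point with nonzero imaginary part. -/
lemma Complex.im_cot_half_add_mul_I (x s : ℝ) (hs : s ≠ 0) :
    (Complex.cot ((x + s * Complex.I) / 2)).im =
      -(Real.sinh s / (Real.cosh s - Real.cos x)) := by
  have hz : ((x : ℂ) + s * Complex.I) / 2 = (x / 2 : ℝ) + (s / 2 : ℝ) * Complex.I := by
    push_cast; ring
  have hx1 : Real.cos x = 2 * Real.cos (x / 2) ^ 2 - 1 := by
    rw [← Real.cos_two_mul]; ring_nf
  have hs1 : Real.cosh s = Real.cosh (s / 2) ^ 2 + Real.sinh (s / 2) ^ 2 := by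
    rw [← Real.cosh_two_mul]; ring_nf
  have hs2 : Real.sinh s = 2 * Real.sinh (s / 2) * Real.cosh (s / 2) := by
    rw [← Real.sinh_two_mul]; ring_nf
  have hsin : Real.sinh (s / 2) ≠ 0 := by simpa using hs
  have hcs := Real.sin_sq_add_cos_sq (x / 2)
  have hch := Real.cosh_sq (s / 2)
  rw [hz, Complex.cot, Complex.sin_add_mul_I, Complex.cos_add_mul_I, hx1, hs1, hs2]
  simp only [← Complex.ofReal_sin, ← Complex.ofReal_cos, ← Complex.ofReal_sinh,
    ← Complex.ofReal_cosh]
  generalize Real.sin (x / 2) = a at *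
  generalize Real.cos (x / 2) = b at *
  generalize Real.sinh (s / 2) = c at *
  generalize Real.cosh (s / 2) = d at *
  have hnum : a ^ 2 * d ^ 2 + c ^ 2 * b ^ 2 = a ^ 2 + c ^ 2 := by
    linear_combination a ^ 2 * hch + c ^ 2 * hcs
  have hden : d ^ 2 + c ^ 2 - (b ^ 2 * 2 - 1) = 2 * (a ^ 2 + c ^ 2) := by
    linear_combination hch - 2 * hcs
  have hne : a ^ 2 + c ^ 2 ≠ 0 := by positivity
  simp [Complex.div_im, Complex.normSq_apply]
  field_simp
  rw [hnum, hden]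
  field_simp
  linear_combination -d * hcs

/-- For a nonnegative function on `ℤ`, a symmetric sum is an unconditional sum. -/
lemma HasSum.of_symm_of_nonneg {f : ℤ → ℝ} (hf : ∀ k, 0 ≤ f k) {a : ℝ}
    (h : HasSum (fun n : ℕ ↦ f (n + 1) + f (-(n + 1))) a) : HasSum f (f 0 + a) := by
  have h₁ : Summable fun n : ℕ ↦ f (n + 1) :=
    h.summable.of_nonneg_of_le (fun _ ↦ hf _) fun _ ↦ le_add_of_nonneg_right (hf _)
  have h₂ : Summable fun n : ℕ ↦ f (-(n + 1)) :=
    h.summable.of_nonneg_of_le (fun _ ↦ hf _) fun _ ↦ le_add_of_nonneg_left (hf _)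
  convert h₁.hasSum.of_add_one_of_neg_add_one h₂.hasSum using 1
  rw [h.unique (h₁.hasSum.add h₂.hasSum)]
  ring

/-- Each Cauchy term is the imaginary part of a simple fraction. -/
lemma Complex.im_one_div_add_mul_I_div_two_pi_add (x s t : ℝ) (hs : s ≠ 0) :
    (1 / (((x : ℂ) + s * Complex.I) / (2 * π) + t)).im =
      -(2 * π ^ 2) * (s / (π * (s ^ 2 + (x + 2 * π * t) ^ 2))) := by
  have hz : ((x : ℂ) + s * Complex.I) / (2 * π) + t =
      ((x / (2 * π) + t : ℝ) : ℂ) + (s / (2 * π) : ℝ) * Complex.I := by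
    push_cast; ring
  have h₁ : s ^ 2 + (x + 2 * π * t) ^ 2 ≠ 0 := by positivity
  have h₂ : (x / (2 * π) + t) ^ 2 + (s / (2 * π)) ^ 2 =
      (s ^ 2 + (x + 2 * π * t) ^ 2) / (2 * π) ^ 2 := by
    field_simp; ring
  rw [hz, one_div, Complex.inv_im, Complex.normSq_add_mul_I, h₂]
  simp only [Complex.add_im, Complex.ofReal_im, Complex.im_ofReal_mul, Complex.I_im]
  field_simp
  ring

/-- closed form for the wrapped Cauchy series: for `κ > 0` and
`φ ∈ [-π, π]`,
`Σ_{k∈ℤ} √κ/(π(κ + (φ+2πk)²)) = (1/2π) · sinh(√κ)/(cosh(√κ) − cos φ)`. -/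
theorem wrapped_cauchy_closed_form
    (κ : ℝ) (hκ : 0 < κ) (φ : ℝ) (hφ : φ ∈ Set.Icc (-π) π) :
    (∑' k : ℤ, Real.sqrt κ / (π * (κ + (φ + 2 * π * k) ^ 2))) =
      (1 / (2 * π)) * Real.sinh (Real.sqrt κ) / (Real.cosh (Real.sqrt κ) - Real.cos φ) := by
  obtain ⟨s, hs, rfl⟩ : ∃ s : ℝ, 0 < s ∧ κ = s ^ 2 :=
    ⟨√κ, Real.sqrt_pos.2 hκ, (Real.sq_sqrt hκ.le).symm⟩
  rw [Real.sqrt_sq hs.le]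
  set z : ℂ := ((φ : ℂ) + s * Complex.I) / (2 * π) with hz
  set f : ℤ → ℝ := fun k ↦ s / (π * (s ^ 2 + (φ + 2 * π * k) ^ 2))
  have hzim : z.im = s / (2 * π) := by
    have : z = ((φ / (2 * π) : ℝ) : ℂ) + (s / (2 * π) : ℝ) * Complex.I := by
      rw [hz]; push_cast; ring
    rw [this]; simp [-Complex.ofReal_div]
  have hzmem : z ∈ Complex.integerComplement := by
    rintro ⟨n, hn⟩
    have : z.im ≠ 0 := by rw [hzim]; positivity
    exact this (by simp [← hn])
  have hterm (k : ℤ) : (1 / (z + k)).im = -(2 * π ^ 2) * f k := by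
    simpa using Complex.im_one_div_add_mul_I_div_two_pi_add φ s k hs.ne'
  have hcot : (π * Complex.cot (π * z)).im =
      -(π * (Real.sinh s / (Real.cosh s - Real.cos φ))) := by
    have : π * z = ((φ : ℂ) + s * Complex.I) / 2 := by
      rw [hz]; field_simp
    rw [this, Complex.im_ofReal_mul, Complex.im_cot_half_add_mul_I φ s hs.ne', mul_neg]
  have hsum : HasSum (fun n : ℕ ↦ f (n + 1) + f (-(n + 1)))
      ((-(2 * π ^ 2))⁻¹ * (π * Complex.cot (π * z) - 1 / z).im) := by
    have hpair (n : ℕ) : f (n + 1) + f (-(n + 1)) =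
        (-(2 * π ^ 2))⁻¹ * (1 / (z - (n + 1)) + 1 / (z + (n + 1))).im := by
      have h₁ := hterm (n + 1)
      have h₂ := hterm (-(n + 1))
      rw [Int.cast_neg, ← sub_eq_add_neg] at h₂
      push_cast at h₁ h₂
      rw [Complex.add_im, h₁, h₂]
      field_simp
      ring
    simp_rw [hpair]
    rw [cot_series_rep' hzmem]
    exact (Complex.hasSum_im (summable_cotTerm hzmem).hasSum).mul_left _
  have h0 : (1 / z).im = -(2 * π ^ 2) * f 0 := by simpa using hterm 0
  rw [(HasSum.of_symm_of_nonneg (fun k ↦ by positivity) hsum).tsum_eq, Complex.sub_im, hcot, h0]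
  field_simp
  ring
end

section
/- Let γ > 0 and let p_γ(φ) = (2πγ)^{-1/2} Σ_{k∈ℤ} e^{-(φ+2πk)²/(2γ)} be the wrapped normal density on [-π, π]. Then the Kullback–Leibler divergence from the uniform density u ≡ 1/(2π) satisfies D(p_γ‖u) = log₂ φ_E(e^{-γ}) + (2/ln 2) Σ_{k=1}^{∞} (−1)^{k−1} e^{-γ(k²+k)/2} / ( k (1 − e^{-kγ}) ), where φ_E(q) = ∏_{k=1}^{∞} (1 − q^k) is the Euler function. -/
open scoped Real
open MeasureTheory

open Filter Topology

/-- The finite `q`-Pochhammer symbol `(q; q)_n = ∏_{k=1}^n (1 - q^k)`. -/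
noncomputable def qFactorial (q : ℝ) (n : ℕ) : ℝ := ∏ k ∈ Finset.range n, (1 - q ^ (k + 1))

/-- The reciprocal of `(q; q)_m`, extended by zero to negative integers `m`. -/
noncomputable def qFactorialInv (q : ℝ) : ℤ → ℝ
  | Int.ofNat n => (qFactorial q n)⁻¹
  | Int.negSucc _ => 0

/-- The coefficient of `z ^ j` in `∏_{n < N} (1 + s^(2n+1) z) (1 + s^(2n+1) z⁻¹)`. -/
noncomputable def tripleCoeff (s : ℝ) (N : ℕ) (j : ℤ) : ℝ :=
  qFactorial (s ^ 2) (2 * N) * qFactorialInv (s ^ 2) (N + j) * qFactorialInv (s ^ 2) (N - j) *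
    s ^ (j ^ 2)

section qFactorial

variable {q : ℝ}

lemma one_sub_pow_succ_pos (hq0 : 0 < q) (hq1 : q < 1) (k : ℕ) : 0 < 1 - q ^ (k + 1) :=
  sub_pos.2 (pow_lt_one₀ hq0.le hq1 k.succ_ne_zero)

lemma qFactorial_succ (q : ℝ) (n : ℕ) :
    qFactorial q (n + 1) = qFactorial q n * (1 - q ^ (n + 1)) :=
  Finset.prod_range_succ _ _

lemma qFactorial_pos (hq0 : 0 < q) (hq1 : q < 1) (n : ℕ) : 0 < qFactorial q n :=
  Finset.prod_pos fun k _ ↦ one_sub_pow_succ_pos hq0 hq1 k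

lemma qFactorial_le_one (hq0 : 0 < q) (hq1 : q < 1) (n : ℕ) : qFactorial q n ≤ 1 :=
  Finset.prod_le_one (fun k _ ↦ (one_sub_pow_succ_pos hq0 hq1 k).le)
    fun k _ ↦ sub_le_self _ (by positivity)

lemma qFactorial_antitone (hq0 : 0 < q) (hq1 : q < 1) : Antitone (qFactorial q) :=
  antitone_nat_of_succ_le fun n ↦ by
    rw [qFactorial_succ]
    exact mul_le_of_le_one_right (qFactorial_pos hq0 hq1 n).le (sub_le_self _ (by positivity))

lemma summable_log_one_sub_pow (hq0 : 0 < q) (hq1 : q < 1) :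
    Summable fun k : ℕ ↦ Real.log (1 - q ^ (k + 1)) := by
  simp_rw [sub_eq_add_neg]
  exact Real.summable_log_one_add_of_summable
    ((summable_nat_add_iff 1).2 (summable_geometric_of_lt_one hq0.le hq1)).neg

lemma tprod_one_sub_pow_pos (hq0 : 0 < q) (hq1 : q < 1) : 0 < ∏' k : ℕ, (1 - q ^ (k + 1)) := by
  rw [← Real.rexp_tsum_eq_tprod (one_sub_pow_succ_pos hq0 hq1) (summable_log_one_sub_pow hq0 hq1)]
  exact Real.exp_pos _

lemma tendsto_qFactorial (hq0 : 0 < q) (hq1 : q < 1) :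
    Tendsto (qFactorial q) atTop (𝓝 (∏' k : ℕ, (1 - q ^ (k + 1)))) :=
  (Real.multipliable_of_summable_log (one_sub_pow_succ_pos hq0 hq1)
    (summable_log_one_sub_pow hq0 hq1)).hasProd.tendsto_prod_nat

lemma tprod_le_qFactorial (hq0 : 0 < q) (hq1 : q < 1) (n : ℕ) :
    ∏' k : ℕ, (1 - q ^ (k + 1)) ≤ qFactorial q n :=
  (qFactorial_antitone hq0 hq1).le_of_tendsto (tendsto_qFactorial hq0 hq1) n

lemma qFactorialInv_natCast (q : ℝ) (n : ℕ) : qFactorialInv q n = (qFactorial q n)⁻¹ := rfl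

lemma qFactorialInv_of_neg (q : ℝ) {m : ℤ} (hm : m < 0) : qFactorialInv q m = 0 := by
  obtain ⟨n, rfl⟩ := Int.eq_negSucc_of_lt_zero hm
  rfl

lemma qFactorialInv_nonneg (hq0 : 0 < q) (hq1 : q < 1) : ∀ m : ℤ, 0 ≤ qFactorialInv q m
  | Int.ofNat n => inv_nonneg.2 (qFactorial_pos hq0 hq1 n).le
  | Int.negSucc _ => le_rfl

lemma qFactorialInv_le (hq0 : 0 < q) (hq1 : q < 1) :
    ∀ m : ℤ, qFactorialInv q m ≤ (∏' k : ℕ, (1 - q ^ (k + 1)))⁻¹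
  | Int.ofNat n => inv_anti₀ (tprod_one_sub_pow_pos hq0 hq1) (tprod_le_qFactorial hq0 hq1 n)
  | Int.negSucc _ => inv_nonneg.2 (tprod_one_sub_pow_pos hq0 hq1).le

lemma qFactorialInv_eq_mul (hq0 : 0 < q) (hq1 : q < 1) (m : ℤ) :
    qFactorialInv q m = (1 - q ^ (m + 1)) * qFactorialInv q (m + 1) := by
  rcases lt_trichotomy m (-1) with h | rfl | h
  · rw [qFactorialInv_of_neg q (by lia), qFactorialInv_of_neg q (by lia), mul_zero]
  · simp [qFactorialInv_of_neg]
  · lift m to ℕ using by lia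
    have h1 := (one_sub_pow_succ_pos hq0 hq1 m).ne'
    have h2 := (qFactorial_pos hq0 hq1 m).ne'
    norm_cast
    rw [qFactorialInv_natCast, qFactorialInv_natCast, qFactorial_succ]
    field_simp

lemma tendsto_qFactorialInv (hq0 : 0 < q) (hq1 : q < 1) :
    Tendsto (qFactorialInv q) atTop (𝓝 (∏' k : ℕ, (1 - q ^ (k + 1)))⁻¹) := by
  have h := ((tendsto_qFactorial hq0 hq1).inv₀ (tprod_one_sub_pow_pos hq0 hq1).ne').comp
    (tendsto_atTop_atTop_of_monotone (fun _ _ h ↦ Int.toNat_le_toNat h) fun n ↦ ⟨n, by simp⟩)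
  refine h.congr' ?_
  filter_upwards [eventually_ge_atTop 0] with m hm
  lift m to ℕ using hm
  simp [qFactorialInv_natCast]

end qFactorial

section tripleCoeff

variable {s : ℝ}

lemma tripleCoeff_zero (s : ℝ) (j : ℤ) : tripleCoeff s 0 j = if j = 0 then 1 else 0 := by
  rcases lt_trichotomy j 0 with h | rfl | h
  · simp [tripleCoeff, qFactorialInv_of_neg, h, h.ne]
  · simp [tripleCoeff, qFactorialInv, qFactorial]
  · simp [tripleCoeff, qFactorialInv_of_neg, h, h.ne']

lemma tripleCoeff_succ (hs0 : 0 < s) (hs1 : s < 1) (N : ℕ) (j : ℤ) :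
    tripleCoeff s (N + 1) j = (1 + s ^ (2 * (2 * N + 1))) * tripleCoeff s N j +
      s ^ (2 * N + 1) * (tripleCoeff s N (j - 1) + tripleCoeff s N (j + 1)) := by
  have hq0 : 0 < s ^ 2 := by positivity
  have hq1 : s ^ 2 < 1 := pow_lt_one₀ hs0.le hs1 two_ne_zero
  have hs : s ≠ 0 := hs0.ne'
  have e1 : ((N + 1 : ℕ) : ℤ) + j = N + j + 1 := by push_cast; ring
  have e2 : ((N + 1 : ℕ) : ℤ) - j = N - j + 1 := by push_cast; ring
  have e3 : (N : ℤ) + (j - 1) = N + j - 1 := by ring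
  have e4 : (N : ℤ) - (j - 1) = N - j + 1 := by ring
  have e5 : (N : ℤ) + (j + 1) = N + j + 1 := by ring
  have e6 : (N : ℤ) - (j + 1) = N - j - 1 := by ring
  have r1 := qFactorialInv_eq_mul hq0 hq1 (N + j)
  have r2 := qFactorialInv_eq_mul hq0 hq1 (N - j)
  have r3 := qFactorialInv_eq_mul hq0 hq1 (N + j - 1)
  have r4 := qFactorialInv_eq_mul hq0 hq1 (N - j - 1)
  simp only [sub_add_cancel] at r3 r4
  have p1 : s ^ ((j - 1) ^ 2) = s ^ (j ^ 2) * s / (s ^ j) ^ 2 := by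
    rw [show (j - 1) ^ 2 = j ^ 2 + 1 - (j + j) by ring, zpow_sub₀ hs, zpow_add₀ hs, zpow_add₀ hs,
      zpow_one, sq (s ^ j)]
  have p2 : s ^ ((j + 1) ^ 2) = s ^ (j ^ 2) * s * (s ^ j) ^ 2 := by
    rw [show (j + 1) ^ 2 = j ^ 2 + 1 + (j + j) by ring, zpow_add₀ hs, zpow_add₀ hs, zpow_add₀ hs,
      zpow_one, sq (s ^ j)]
  have hv : s ^ j ≠ 0 := zpow_ne_zero _ hs
  have q1 : (s ^ 2) ^ ((N : ℤ) + j) = (s ^ N) ^ 2 * (s ^ j) ^ 2 := by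
    rw [zpow_add₀ (by positivity), zpow_natCast, ← pow_mul, ← pow_mul, mul_comm 2 N,
      ← zpow_natCast s 2, ← zpow_natCast (s ^ j), ← zpow_mul, ← zpow_mul, mul_comm j]
  have q2 : (s ^ 2) ^ ((N : ℤ) - j) = (s ^ N) ^ 2 / (s ^ j) ^ 2 := by
    rw [zpow_sub₀ (by positivity), zpow_natCast, ← pow_mul, ← pow_mul, mul_comm 2 N,
      ← zpow_natCast s 2, ← zpow_natCast (s ^ j), ← zpow_mul, ← zpow_mul, mul_comm j]
  have q3 : (s ^ 2) ^ ((N : ℤ) + j + 1) = (s ^ N) ^ 2 * (s ^ j) ^ 2 * s ^ 2 := by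
    rw [zpow_add₀ (by positivity), q1, zpow_one]
  have q4 : (s ^ 2) ^ ((N : ℤ) - j + 1) = (s ^ N) ^ 2 / (s ^ j) ^ 2 * s ^ 2 := by
    rw [zpow_add₀ (by positivity), q2, zpow_one]
  simp only [tripleCoeff]
  rw [e1, e2, e3, e4, e5, e6, r3, r4, r1, r2, p1, p2, q1, q2, q3, q4,
    show 2 * (N + 1) = 2 * N + 1 + 1 by ring, qFactorial_succ, qFactorial_succ]
  generalize qFactorialInv (s ^ 2) (N + j + 1) = A
  generalize qFactorialInv (s ^ 2) (N - j + 1) = B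
  generalize qFactorial (s ^ 2) (2 * N) = C
  generalize s ^ (j ^ 2) = D
  have t1 : (s ^ 2) ^ (2 * N + 1) = (s ^ N) ^ 4 * s ^ 2 := by ring
  have t2 : (s ^ 2) ^ (2 * N + 1 + 1) = (s ^ N) ^ 4 * s ^ 4 := by ring
  have t3 : s ^ (2 * (2 * N + 1)) = (s ^ N) ^ 4 * s ^ 2 := by ring
  have t4 : s ^ (2 * N + 1) = (s ^ N) ^ 2 * s := by ring
  rw [t1, t2, t3, t4]
  generalize s ^ N = u
  generalize s ^ j = v at hv
  field_simp
  ring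

/-- The finite form of the Jacobi triple product identity. -/
theorem hasSum_tripleCoeff (hs0 : 0 < s) (hs1 : s < 1) {z : ℂ} (hz : z ≠ 0) (N : ℕ) :
    HasSum (fun j : ℤ ↦ (tripleCoeff s N j : ℂ) * z ^ j)
      (∏ n ∈ Finset.range N,
        (1 + (s : ℂ) ^ (2 * n + 1) * z) * (1 + (s : ℂ) ^ (2 * n + 1) * z⁻¹)) := by
  induction N with
  | zero =>
    simp only [tripleCoeff_zero, Finset.range_zero, Finset.prod_empty]
    convert! hasSum_ite_eq (0 : ℤ) (1 : ℂ) using 2 with j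
    split_ifs with h <;> simp [h]
  | succ N ih =>
    have h1 := (((Equiv.addRight (-1 : ℤ)).hasSum_iff.2 ih).mul_left z)
    have h2 := (((Equiv.addRight (1 : ℤ)).hasSum_iff.2 ih).mul_left z⁻¹)
    rw [Finset.prod_range_succ]
    convert! (ih.mul_left (1 + (s : ℂ) ^ (2 * (2 * N + 1)))).add
      ((h1.add h2).mul_left ((s : ℂ) ^ (2 * N + 1))) using 1
    · ext j
      simp only [tripleCoeff_succ hs0 hs1, Function.comp_apply, Equiv.coe_addRight,
        zpow_add₀ hz, ← sub_eq_add_neg, zpow_sub₀ hz, zpow_one]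
      push_cast
      field_simp
    · linear_combination (∏ n ∈ Finset.range N, (1 + (s : ℂ) ^ (2 * n + 1) * z) *
        (1 + (s : ℂ) ^ (2 * n + 1) * z⁻¹)) * (s : ℂ) ^ (2 * (2 * N + 1)) * mul_inv_cancel₀ hz

lemma summable_pow_sq_int (hs0 : 0 < s) (hs1 : s < 1) : Summable fun j : ℤ ↦ s ^ (j ^ 2) := by
  have h : Summable fun n : ℕ ↦ s ^ (n ^ 2) :=
    (summable_geometric_of_lt_one hs0.le hs1).of_nonneg_of_le (fun n ↦ by positivity)
      fun n ↦ pow_le_pow_of_le_one hs0.le hs1.le (Nat.le_self_pow two_ne_zero n)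
  refine Summable.of_nat_of_neg ?_ ?_
  · exact_mod_cast h
  · simp only [neg_sq]
    exact_mod_cast h

/-- The Jacobi triple product identity on the unit circle, as a limit of partial products. -/
theorem tendsto_prod_tripleProduct (hs0 : 0 < s) (hs1 : s < 1) {z : ℂ} (hz : ‖z‖ = 1) :
    Tendsto (fun N ↦ ∏ n ∈ Finset.range N,
        (1 + (s : ℂ) ^ (2 * n + 1) * z) * (1 + (s : ℂ) ^ (2 * n + 1) * z⁻¹)) atTop
      (𝓝 (((∏' k : ℕ, (1 - (s ^ 2) ^ (k + 1)))⁻¹ : ℝ) *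
        ∑' j : ℤ, ((s ^ (j ^ 2) : ℝ) : ℂ) * z ^ j)) := by
  have hz0 : z ≠ 0 := norm_ne_zero_iff.1 (by simp [hz])
  have hq0 : 0 < s ^ 2 := by positivity
  have hq1 : s ^ 2 < 1 := pow_lt_one₀ hs0.le hs1 two_ne_zero
  have hE := tprod_one_sub_pow_pos hq0 hq1
  set E := ∏' k : ℕ, (1 - (s ^ 2) ^ (k + 1))
  simp_rw [← fun N ↦ (hasSum_tripleCoeff hs0 hs1 hz0 N).tsum_eq]
  rw [← tsum_mul_left]
  refine tendsto_tsum_of_dominated_convergence (bound := fun j : ℤ ↦ E⁻¹ * E⁻¹ * s ^ (j ^ 2))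
    ((summable_pow_sq_int hs0 hs1).mul_left _) (fun j ↦ ?_) (.of_forall fun N j ↦ ?_)
  · rw [← mul_assoc, ← Complex.ofReal_mul]
    refine ((Complex.continuous_ofReal.tendsto _).comp ?_).mul_const _
    have h1 : Tendsto (fun N : ℕ ↦ qFactorial (s ^ 2) (2 * N)) atTop (𝓝 E) :=
      (tendsto_qFactorial hq0 hq1).comp (tendsto_id.const_mul_atTop' two_pos)
    have h2 : Tendsto (fun N : ℕ ↦ qFactorialInv (s ^ 2) (N + j)) atTop (𝓝 E⁻¹) :=
      (tendsto_qFactorialInv hq0 hq1).comp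
        (tendsto_atTop_add_const_right _ _ tendsto_natCast_atTop_atTop)
    have h3 : Tendsto (fun N : ℕ ↦ qFactorialInv (s ^ 2) (N - j)) atTop (𝓝 E⁻¹) :=
      (tendsto_qFactorialInv hq0 hq1).comp
        (tendsto_atTop_add_const_right _ (-j) tendsto_natCast_atTop_atTop)
    have h := ((h1.mul h2).mul h3).mul_const (s ^ (j ^ 2))
    rwa [mul_inv_cancel₀ hE.ne', one_mul] at h
  · have h1 := qFactorialInv_nonneg hq0 hq1
    have h2 := qFactorialInv_le hq0 hq1
    have h3 := (qFactorial_pos hq0 hq1 (2 * N)).le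
    have h4 := qFactorial_le_one hq0 hq1 (2 * N)
    rw [norm_mul, norm_zpow, hz, one_zpow, mul_one, Complex.norm_real, tripleCoeff,
      Real.norm_of_nonneg
        (mul_nonneg (mul_nonneg (mul_nonneg h3 (h1 _)) (h1 _)) (by positivity))]
    gcongr
    · exact h1 _
    · calc _ ≤ 1 * E⁻¹ := mul_le_mul h4 (h2 _) (h1 _) zero_le_one
        _ = E⁻¹ := one_mul _
    · exact h2 _

end tripleCoeff

section logSeries

variable {s : ℝ}

lemma hasSum_log_norm_one_add {r : ℝ} (hr0 : 0 < r) (hr1 : r < 1) (φ : ℝ) :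
    HasSum (fun k : ℕ ↦ (-1) ^ k / ((k : ℝ) + 1) * r ^ (k + 1) * Real.cos ((k + 1) * φ))
      (Real.log ‖1 + (r : ℂ) * Complex.exp (φ * Complex.I)‖) := by
  have hz : ‖(r : ℂ) * Complex.exp (φ * Complex.I)‖ < 1 := by
    rwa [norm_mul, Complex.norm_exp_ofReal_mul_I, mul_one, Complex.norm_of_nonneg hr0.le]
  have h := (hasSum_nat_add_iff' 1).2 (Complex.hasSum_taylorSeries_log hz)
  have h := Complex.hasSum_re h
  simp only [Finset.range_one, Finset.sum_singleton, Nat.cast_zero, div_zero, sub_zero,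
    Complex.log_re] at h
  refine h.congr_fun ?_
  intro k
  have e : (-1 : ℂ) ^ (k + 1 + 1) * ((r : ℂ) * Complex.exp (φ * Complex.I)) ^ (k + 1) /
      ((k + 1 : ℕ) : ℂ) = (((-1) ^ k / ((k : ℝ) + 1) * r ^ (k + 1) : ℝ) : ℂ) *
        Complex.exp (((k + 1) * φ : ℝ) * Complex.I) := by
    rw [mul_pow, ← Complex.exp_nat_mul, pow_succ, pow_succ]
    push_cast
    ring_nf
  rw [e, Complex.re_ofReal_mul, Complex.exp_ofReal_mul_I_re]

/-- The Fourier cosine coefficients of the logarithm of the theta function. -/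
noncomputable def logThetaCoeff (s : ℝ) (k : ℕ) : ℝ :=
  2 * ((-1) ^ k / ((k : ℝ) + 1) * (s ^ (k + 1) / (1 - (s ^ 2) ^ (k + 1))))

lemma norm_two_mul_neg_one_pow_div_le (k : ℕ) : ‖2 * ((-1 : ℝ) ^ k / ((k : ℝ) + 1))‖ ≤ 2 := by
  rw [norm_mul, norm_div, norm_pow, norm_neg, norm_one, one_pow, Real.norm_two,
    Real.norm_of_nonneg (by positivity)]
  have : 1 / ((k : ℝ) + 1) ≤ 1 := div_le_one_of_le₀ (by simp) (by positivity)
  linarith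

lemma div_one_sub_pow_le (hs0 : 0 < s) (hs1 : s < 1) (k : ℕ) :
    s ^ (k + 1) / (1 - (s ^ 2) ^ (k + 1)) ≤ s ^ k / (1 - s ^ 2) := by
  have hq0 : 0 < s ^ 2 := by positivity
  have hq1 : s ^ 2 < 1 := pow_lt_one₀ hs0.le hs1 two_ne_zero
  have := sub_pos.2 hq1
  refine div_le_div₀ (by positivity) (pow_le_pow_of_le_one hs0.le hs1.le k.le_succ) this ?_
  exact sub_le_sub_left (pow_le_of_le_one hq0.le hq1.le k.succ_ne_zero) 1

lemma summable_two_mul_pow_div (hs0 : 0 < s) (hs1 : s < 1) :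
    Summable fun k : ℕ ↦ 2 * (s ^ k / (1 - s ^ 2)) :=
  ((summable_geometric_of_lt_one hs0.le hs1).div_const _).mul_left _

lemma norm_logThetaCoeff_le (hs0 : 0 < s) (hs1 : s < 1) (k : ℕ) :
    ‖logThetaCoeff s k‖ ≤ 2 * (s ^ k / (1 - s ^ 2)) := by
  have h := one_sub_pow_succ_pos (q := s ^ 2) (by positivity)
    (pow_lt_one₀ hs0.le hs1 two_ne_zero) k
  rw [logThetaCoeff, ← mul_assoc, norm_mul, Real.norm_of_nonneg (r := _ / _) (by positivity)]
  exact mul_le_mul (norm_two_mul_neg_one_pow_div_le k) (div_one_sub_pow_le hs0 hs1 k)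
    (by positivity) zero_le_two

lemma hasSum_logTheta (hs0 : 0 < s) (hs1 : s < 1) (φ : ℝ) :
    HasSum (fun k : ℕ ↦ logThetaCoeff s k * Real.cos ((k + 1) * φ))
      (∑' k : ℕ, logThetaCoeff s k * Real.cos ((k + 1) * φ)) := by
  refine Summable.hasSum (.of_norm_bounded (summable_two_mul_pow_div hs0 hs1) fun k ↦ ?_)
  rw [norm_mul]
  exact (mul_le_of_le_one_right (norm_nonneg _) (Real.abs_cos_le_one _)).trans
    (norm_logThetaCoeff_le hs0 hs1 k)

lemma sum_odd_pow_eq (hs0 : 0 < s) (hs1 : s < 1) (N k : ℕ) :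
    ∑ n ∈ Finset.range N, (s ^ (2 * n + 1)) ^ (k + 1) =
      s ^ (k + 1) / (1 - (s ^ 2) ^ (k + 1)) * (1 - ((s ^ 2) ^ (k + 1)) ^ N) := by
  have h := one_sub_pow_succ_pos (q := s ^ 2) (by positivity)
    (pow_lt_one₀ hs0.le hs1 two_ne_zero) k
  have e (n : ℕ) : (s ^ (2 * n + 1)) ^ (k + 1) = s ^ (k + 1) * ((s ^ 2) ^ (k + 1)) ^ n := by ring
  simp_rw [e]
  rw [← Finset.mul_sum, div_mul_eq_mul_div, eq_div_iff h.ne', mul_assoc,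
    ← mul_neg_geom_sum ((s ^ 2) ^ (k + 1)) N]
  ring

lemma tendsto_sum_log_norm (hs0 : 0 < s) (hs1 : s < 1) (φ : ℝ) :
    Tendsto (fun N ↦ ∑ n ∈ Finset.range N,
        2 * Real.log ‖1 + ((s ^ (2 * n + 1) : ℝ) : ℂ) * Complex.exp (φ * Complex.I)‖) atTop
      (𝓝 (∑' k : ℕ, logThetaCoeff s k * Real.cos ((k + 1) * φ))) := by
  have h (N : ℕ) := hasSum_sum (s := Finset.range N) fun n _ ↦ (hasSum_log_norm_one_add
    (r := s ^ (2 * n + 1)) (by positivity)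
    (pow_lt_one₀ hs0.le hs1 (2 * n).succ_ne_zero) φ).mul_left 2
  have e (N k : ℕ) : ∑ n ∈ Finset.range N, 2 * ((-1) ^ k / ((k : ℝ) + 1) *
      (s ^ (2 * n + 1)) ^ (k + 1) * Real.cos ((k + 1) * φ)) =
      logThetaCoeff s k * Real.cos ((k + 1) * φ) * (1 - ((s ^ 2) ^ (k + 1)) ^ N) := by
    rw [← Finset.mul_sum, ← Finset.sum_mul, ← Finset.mul_sum, sum_odd_pow_eq hs0 hs1, logThetaCoeff]
    ring
  simp_rw [← fun N ↦ (h N).tsum_eq, e]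
  have hq0 : 0 < s ^ 2 := by positivity
  have hq1 : s ^ 2 < 1 := pow_lt_one₀ hs0.le hs1 two_ne_zero
  refine tendsto_tsum_of_dominated_convergence (summable_two_mul_pow_div hs0 hs1) (fun k ↦ ?_)
    (.of_forall fun N k ↦ ?_)
  · have := (tendsto_pow_atTop_nhds_zero_of_lt_one (r := (s ^ 2) ^ (k + 1)) (by positivity)
      (pow_lt_one₀ hq0.le hq1 k.succ_ne_zero)).const_sub 1
    simpa using this.const_mul (logThetaCoeff s k * Real.cos ((k + 1) * φ))
  · have h1 : ((s ^ 2) ^ (k + 1)) ^ N ≤ 1 := pow_le_one₀ (by positivity)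
      (pow_le_one₀ hq0.le hq1.le)
    rw [norm_mul, norm_mul]
    refine (mul_le_of_le_one_right (by positivity) ?_).trans
      ((mul_le_of_le_one_right (norm_nonneg _) (Real.abs_cos_le_one _)).trans
        (norm_logThetaCoeff_le hs0 hs1 k))
    rw [Real.norm_of_nonneg (sub_nonneg.2 h1)]
    exact sub_le_self _ (by positivity)

lemma one_add_ne_zero_of_norm_lt_one {z : ℂ} (hz : ‖z‖ < 1) : 1 + z ≠ 0 := fun h ↦ by
  rw [← neg_eq_of_add_eq_zero_right h] at hz
  simp at hz

/-- The theta function on the unit circle is the exponential of its logarithmic cosine series. -/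
theorem tsum_theta_eq_exp (hs0 : 0 < s) (hs1 : s < 1) (φ : ℝ) :
    ∑' j : ℤ, ((s ^ (j ^ 2) : ℝ) : ℂ) * Complex.exp (φ * Complex.I) ^ j =
      (((∏' k : ℕ, (1 - (s ^ 2) ^ (k + 1))) *
        Real.exp (∑' k : ℕ, logThetaCoeff s k * Real.cos ((k + 1) * φ)) : ℝ) : ℂ) := by
  have hE := tprod_one_sub_pow_pos (q := s ^ 2) (by positivity)
    (pow_lt_one₀ hs0.le hs1 two_ne_zero)
  have h1 := tendsto_prod_tripleProduct hs0 hs1 (Complex.norm_exp_ofReal_mul_I φ)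
  have h2 := (Complex.continuous_ofReal.tendsto _).comp
    ((Real.continuous_exp.tendsto _).comp (tendsto_sum_log_norm hs0 hs1 φ))
  have e : (fun N ↦ ∏ n ∈ Finset.range N,
      (1 + (s : ℂ) ^ (2 * n + 1) * Complex.exp (φ * Complex.I)) *
        (1 + (s : ℂ) ^ (2 * n + 1) * (Complex.exp (φ * Complex.I))⁻¹)) =
      Complex.ofReal ∘ Real.exp ∘ fun N ↦ ∑ n ∈ Finset.range N,
        2 * Real.log ‖1 + ((s ^ (2 * n + 1) : ℝ) : ℂ) * Complex.exp (φ * Complex.I)‖ := by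
    ext N
    simp only [Function.comp_apply]
    rw [Real.exp_sum, Complex.ofReal_prod]
    refine Finset.prod_congr rfl fun n _ ↦ ?_
    have hn : 1 + ((s ^ (2 * n + 1) : ℝ) : ℂ) * Complex.exp (φ * Complex.I) ≠ 0 := by
      apply one_add_ne_zero_of_norm_lt_one
      rw [norm_mul, Complex.norm_exp_ofReal_mul_I, mul_one, Complex.norm_of_nonneg (by positivity)]
      exact pow_lt_one₀ hs0.le hs1 (2 * n).succ_ne_zero
    rw [two_mul (Real.log _), Real.exp_add, Real.exp_log (norm_pos_iff.2 hn), ← sq, Complex.ofReal_pow,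
      ← Complex.mul_conj', map_add, map_mul, Complex.conj_ofReal, ← Complex.exp_conj, map_mul,
      Complex.conj_ofReal, Complex.conj_I, mul_neg, Complex.exp_neg, map_one, Complex.ofReal_pow]
  rw [e] at h1
  have h := tendsto_nhds_unique h1 h2
  rw [Complex.ofReal_mul, ← h, ← mul_assoc, ← Complex.ofReal_mul, mul_inv_cancel₀ hE.ne',
    Complex.ofReal_one, one_mul]

end logSeries

section wrappedNormal

/-- The wrapped normal density as a Fourier series, by Poisson summation. -/
lemma wrappedNormal_eq_theta {γ : ℝ} (hγ : 0 < γ) (φ : ℝ) :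
    ((1 / Real.sqrt (2 * π * γ) *
      ∑' k : ℤ, Real.exp (-(φ + 2 * π * k) ^ 2 / (2 * γ)) : ℝ) : ℂ) =
      1 / (2 * π) * ∑' j : ℤ, ((Real.exp (-γ / 2) ^ (j ^ 2) : ℝ) : ℂ) *
        Complex.exp (φ * Complex.I) ^ j := by
  have hπ := Real.pi_pos
  have hπ0 : (π : ℂ) ≠ 0 := by exact_mod_cast hπ.ne'
  have hγ0 : (γ : ℂ) ≠ 0 := by exact_mod_cast hγ.ne'
  have ha : 0 < γ / (2 * π) := by positivity
  have h := Complex.tsum_exp_neg_quadratic (a := (γ / (2 * π) : ℝ)) (by rwa [Complex.ofReal_re])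
    (φ * Complex.I / (2 * π))
  have h1 (j : ℤ) : Complex.exp (-π * (γ / (2 * π) : ℝ) * j ^ 2 +
      2 * π * (φ * Complex.I / (2 * π)) * j) =
      ((Real.exp (-γ / 2) ^ (j ^ 2) : ℝ) : ℂ) * Complex.exp (φ * Complex.I) ^ j := by
    rw [Complex.ofReal_zpow, Complex.ofReal_exp, ← Complex.exp_int_mul, ← Complex.exp_int_mul,
      ← Complex.exp_add]
    congr 1
    push_cast
    field_simp
  have h2 (k : ℤ) : Complex.exp (-π / (γ / (2 * π) : ℝ) *
      (k + Complex.I * (φ * Complex.I / (2 * π))) ^ 2) =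
      (Real.exp (-(-φ + 2 * π * k) ^ 2 / (2 * γ)) : ℝ) := by
    rw [Complex.ofReal_exp]
    congr 1
    have : Complex.I * (φ * Complex.I / (2 * π)) = -φ / (2 * π) := by
      linear_combination (φ / (2 * π)) * Complex.I_mul_I
    rw [this]
    push_cast
    field_simp
    ring
  have h3 : ((γ / (2 * π) : ℝ) : ℂ) ^ (1 / 2 : ℂ) = (Real.sqrt (γ / (2 * π)) : ℝ) := by
    rw [Real.sqrt_eq_rpow, Complex.ofReal_cpow ha.le]
    norm_num
  have h4 : 2 * π * (1 / Real.sqrt (2 * π * γ)) = 1 / Real.sqrt (γ / (2 * π)) := by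
    have : 2 * π * γ = (2 * π) ^ 2 * (γ / (2 * π)) := by field_simp
    rw [this, Real.sqrt_mul (by positivity), Real.sqrt_sq (by positivity)]
    field_simp
  have h5 : ∑' k : ℤ, Real.exp (-(-φ + 2 * π * k) ^ 2 / (2 * γ)) =
      ∑' k : ℤ, Real.exp (-(φ + 2 * π * k) ^ 2 / (2 * γ)) := by
    rw [← (Equiv.neg ℤ).tsum_eq]
    refine tsum_congr fun k ↦ ?_
    rw [Equiv.neg_apply]
    push_cast
    ring_nf
  simp_rw [h1, h2, h3] at h
  rw [h, ← Complex.ofReal_tsum, h5, ← Complex.ofReal_one, ← Complex.ofReal_div, ← h4]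
  push_cast
  field_simp

lemma norm_pow_sq_mul_exp {s : ℝ} (hs0 : 0 < s) (j : ℤ) (φ : ℝ) :
    ‖((s ^ (j ^ 2) : ℝ) : ℂ) * Complex.exp (φ * Complex.I) ^ j‖ = s ^ (j ^ 2) := by
  rw [norm_mul, norm_zpow, Complex.norm_exp_ofReal_mul_I, one_zpow, mul_one,
    Complex.norm_of_nonneg (by positivity)]

lemma integral_exp_int_mul (n : ℤ) :
    ∫ φ in (-π)..π, Complex.exp (φ * Complex.I) ^ n = if n = 0 then 2 * (π : ℂ) else 0 := by
  split_ifs with h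
  · simp only [h, zpow_zero, intervalIntegral.integral_const]
    simp
    ring
  · have hn : (n : ℂ) * Complex.I ≠ 0 := mul_ne_zero (Int.cast_ne_zero.2 h) Complex.I_ne_zero
    have e (φ : ℝ) : Complex.exp (φ * Complex.I) ^ n = Complex.exp (n * Complex.I * φ) := by
      rw [← Complex.exp_int_mul]
      ring_nf
    simp_rw [e]
    rw [integral_exp_mul_complex hn, div_eq_zero_iff, sub_eq_zero]
    left
    rw [Complex.exp_eq_exp_iff_exists_int]
    exact ⟨n, by push_cast; ring⟩

/-- The trigonometric moments of a density with theta Fourier series. -/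
lemma integral_theta_mul_cos {s : ℝ} (hs0 : 0 < s) (hs1 : s < 1) {p : ℝ → ℝ}
    (hp : ∀ φ : ℝ, (p φ : ℂ) =
      1 / (2 * π) * ∑' j : ℤ, ((s ^ (j ^ 2) : ℝ) : ℂ) * Complex.exp (φ * Complex.I) ^ j)
    (hpc : Continuous p) (m : ℕ) :
    ∫ φ in (-π)..π, p φ * Real.cos (m * φ) = s ^ (m ^ 2) := by
  have hπ0 : (π : ℂ) ≠ 0 := by exact_mod_cast Real.pi_ne_zero
  have hc : Continuous fun φ : ℝ ↦ (p φ : ℂ) * Complex.exp (φ * Complex.I) ^ m := by fun_prop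
  have hre (φ : ℝ) : p φ * Real.cos (m * φ) =
      Complex.reCLM ((p φ : ℂ) * Complex.exp (φ * Complex.I) ^ m) := by
    rw [← Complex.exp_nat_mul, ← mul_assoc, Complex.reCLM_apply, Complex.re_ofReal_mul,
      ← Complex.exp_ofReal_mul_I_re]
    push_cast
    rfl
  simp_rw [hre]
  rw [Complex.reCLM.intervalIntegral_comp_comm (hc.intervalIntegrable _ _)]
  have key := intervalIntegral.hasSum_integral_of_dominated_convergence (a := -π) (b := π)
    (μ := volume) (F := fun (j : ℤ) (φ : ℝ) ↦ 1 / (2 * (π : ℂ)) * (((s ^ (j ^ 2) : ℝ) : ℂ) *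
      Complex.exp (φ * Complex.I) ^ j) * Complex.exp (φ * Complex.I) ^ m)
    (f := fun φ : ℝ ↦ (p φ : ℂ) * Complex.exp (φ * Complex.I) ^ m)
    (fun j _ ↦ ‖1 / (2 * (π : ℂ))‖ * s ^ (j ^ 2)) (fun j ↦ ?_) (fun j ↦ .of_forall fun φ _ ↦ ?_)
    (.of_forall fun φ _ ↦ (summable_pow_sq_int hs0 hs1).mul_left _) (by simp)
    (.of_forall fun φ _ ↦ ?_)
  · have hF (j : ℤ) : ∫ φ in (-π)..π, 1 / (2 * (π : ℂ)) * (((s ^ (j ^ 2) : ℝ) : ℂ) *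
        Complex.exp (φ * Complex.I) ^ j) * Complex.exp (φ * Complex.I) ^ m =
        if j = -m then ((s ^ (m ^ 2) : ℝ) : ℂ) else 0 := by
      have e (φ : ℝ) : 1 / (2 * (π : ℂ)) * (((s ^ (j ^ 2) : ℝ) : ℂ) *
          Complex.exp (φ * Complex.I) ^ j) * Complex.exp (φ * Complex.I) ^ m =
          1 / (2 * (π : ℂ)) * ((s ^ (j ^ 2) : ℝ) : ℂ) * Complex.exp (φ * Complex.I) ^ (j + m) := by
        rw [zpow_add₀ (Complex.exp_ne_zero _), zpow_natCast]
        ring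
      simp_rw [e]
      rw [intervalIntegral.integral_const_mul, integral_exp_int_mul]
      by_cases h : j = -m
      · subst h
        have : s ^ ((-m : ℤ) ^ 2) = s ^ (m ^ 2) := by
          rw [neg_sq]
          exact_mod_cast rfl
        rw [if_pos (by ring), if_pos rfl, this]
        field_simp
      · rw [if_neg (by lia), if_neg h, mul_zero]
    simp_rw [hF] at key
    rw [key.unique (hasSum_ite_eq _ _), Complex.reCLM_apply, Complex.ofReal_re]
  · refine Continuous.aestronglyMeasurable ?_
    have (j : ℤ) : Continuous fun φ : ℝ ↦ Complex.exp (φ * Complex.I) ^ j :=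
      Continuous.zpow₀ (by fun_prop) j fun _ ↦ .inl (Complex.exp_ne_zero _)
    have := this j
    fun_prop
  · rw [norm_mul, norm_pow, Complex.norm_exp_ofReal_mul_I, one_pow, mul_one, norm_mul,
      norm_pow_sq_mul_exp hs0]
  · rw [hp φ]
    have : Summable fun j : ℤ ↦ ((s ^ (j ^ 2) : ℝ) : ℂ) * Complex.exp (φ * Complex.I) ^ j :=
      .of_norm_bounded (summable_pow_sq_int hs0 hs1) fun j ↦ (norm_pow_sq_mul_exp hs0 j φ).le
    exact (this.hasSum.mul_left _).mul_right _

/-- Integration of the logarithmic cosine series against a density, term by term. -/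
lemma hasSum_integral_mul_logTheta {s : ℝ} (hs0 : 0 < s) (hs1 : s < 1) {p : ℝ → ℝ}
    (hpc : Continuous p) :
    HasSum (fun k : ℕ ↦ logThetaCoeff s k * ∫ φ in (-π)..π, p φ * Real.cos ((k + 1) * φ))
      (∫ φ in (-π)..π, p φ * ∑' k : ℕ, logThetaCoeff s k * Real.cos ((k + 1) * φ)) := by
  simp_rw [← intervalIntegral.integral_const_mul]
  refine intervalIntegral.hasSum_integral_of_dominated_convergence
    (fun k φ ↦ |p φ| * (2 * (s ^ k / (1 - s ^ 2)))) (fun k ↦ ?_) (fun k ↦ .of_forall fun φ _ ↦ ?_)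
    (.of_forall fun φ _ ↦ (summable_two_mul_pow_div hs0 hs1).mul_left _) ?_ (.of_forall fun φ _ ↦ ?_)
  · exact Continuous.aestronglyMeasurable (by fun_prop)
  · rw [mul_left_comm, norm_mul, norm_mul, Real.norm_eq_abs (p φ)]
    refine mul_le_mul_of_nonneg_left ?_ (abs_nonneg _)
    exact (mul_le_of_le_one_right (norm_nonneg _) (Real.abs_cos_le_one _)).trans
      (norm_logThetaCoeff_le hs0 hs1 k)
  · simp_rw [tsum_mul_left]
    exact (hpc.abs.mul_const _).intervalIntegrable _ _
  · simp_rw [mul_left_comm _ (p φ)]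
    exact (hasSum_logTheta hs0 hs1 φ).mul_left _

end wrappedNormal

/-- for the wrapped normal density `p_γ` on `[-π, π]`, the Kullback–Leibler
divergence from the uniform density satisfies
`D(p_γ‖u) = log₂ φ_E(e^{-γ}) + (2/ln 2) Σ_{k≥1} (−1)^{k−1} e^{-γ(k²+k)/2}/(k(1−e^{-kγ}))`,
where `φ_E(q) = ∏_{k≥1} (1 − q^k)` is the Euler function. -/
theorem wrapped_normal_relative_entropy
    (γ : ℝ) (hγ : 0 < γ) (p : ℝ → ℝ)
    (hp : ∀ φ : ℝ, p φ =
      (1 / Real.sqrt (2 * π * γ)) * ∑' k : ℤ, Real.exp (-(φ + 2 * π * k) ^ 2 / (2 * γ))) :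
    (∫ φ in (-π)..π, p φ * Real.logb 2 (2 * π * p φ)) =
      Real.logb 2 (∏' k : ℕ, (1 - Real.exp (-γ) ^ (k + 1))) +
        (2 / Real.log 2) * ∑' k : ℕ,
          (-1 : ℝ) ^ k * Real.exp (-γ * (((k : ℝ) + 1) ^ 2 + ((k : ℝ) + 1)) / 2) /
            (((k : ℝ) + 1) * (1 - Real.exp (-((k : ℝ) + 1) * γ))) := by
  have hs0 := Real.exp_pos (-γ / 2)
  have hs1 : Real.exp (-γ / 2) < 1 := Real.exp_lt_one_iff.2 (by linarith)
  have hq : Real.exp (-γ / 2) ^ 2 = Real.exp (-γ) := by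
    rw [← Real.exp_nat_mul]
    congr 1
    push_cast
    ring
  have hp' (φ : ℝ) := (congrArg Complex.ofReal (hp φ)).trans (wrappedNormal_eq_theta hγ φ)
  have hlogc : Continuous fun φ : ℝ ↦
      ∑' k : ℕ, logThetaCoeff (Real.exp (-γ / 2)) k * Real.cos ((k + 1) * φ) := by
    refine continuous_tsum (fun k ↦ by fun_prop) (summable_two_mul_pow_div hs0 hs1) fun k φ ↦ ?_
    rw [norm_mul]
    exact (mul_le_of_le_one_right (norm_nonneg _) (Real.abs_cos_le_one _)).trans
      (norm_logThetaCoeff_le hs0 hs1 k)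
  have hexp (φ : ℝ) : 2 * π * p φ = (∏' k : ℕ, (1 - Real.exp (-γ) ^ (k + 1))) *
      Real.exp (∑' k : ℕ, logThetaCoeff (Real.exp (-γ / 2)) k * Real.cos ((k + 1) * φ)) := by
    have h := hp' φ
    rw [tsum_theta_eq_exp hs0 hs1, hq] at h
    have hπ : ((2 * π : ℝ) : ℂ) ≠ 0 := Complex.ofReal_ne_zero.2 (by positivity)
    rw [← Complex.ofReal_inj, Complex.ofReal_mul _ (p φ), h, ← mul_assoc,
      show 2 * (π : ℂ) = (2 * π : ℝ) by push_cast; rfl, mul_one_div_cancel hπ, one_mul]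
  have hE := tprod_one_sub_pow_pos (q := Real.exp (-γ)) (Real.exp_pos _)
    (Real.exp_lt_one_iff.2 (by linarith))
  set E := ∏' k : ℕ, (1 - Real.exp (-γ) ^ (k + 1))
  have hpc : Continuous p := by
    have : p = fun φ ↦ E * Real.exp (∑' k : ℕ, logThetaCoeff (Real.exp (-γ / 2)) k *
        Real.cos ((k + 1) * φ)) / (2 * π) := by
      ext φ
      rw [← hexp]
      field_simp
    rw [this]
    fun_prop
  have hmoment := integral_theta_mul_cos hs0 hs1 hp' hpc
  have hint (φ : ℝ) : p φ * Real.logb 2 (2 * π * p φ) =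
      Real.logb 2 E * (p φ * Real.cos ((0 : ℕ) * φ)) + (Real.log 2)⁻¹ * (p φ *
        ∑' k : ℕ, logThetaCoeff (Real.exp (-γ / 2)) k * Real.cos ((k + 1) * φ)) := by
    rw [hexp, Real.logb, Real.log_mul hE.ne' (Real.exp_ne_zero _), Real.log_exp, Real.logb]
    simp only [Nat.cast_zero, zero_mul, Real.cos_zero]
    ring
  simp_rw [hint]
  rw [intervalIntegral.integral_add (Continuous.intervalIntegrable (by fun_prop) _ _)
      (Continuous.intervalIntegrable (by fun_prop) _ _),
    intervalIntegral.integral_const_mul, intervalIntegral.integral_const_mul, hmoment,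
    ← (hasSum_integral_mul_logTheta hs0 hs1 hpc).tsum_eq, div_eq_inv_mul _ (Real.log 2),
    mul_assoc, ← tsum_mul_left (a := (2 : ℝ))]
  congr 1
  · simp
  · congr 1
    refine tsum_congr fun k ↦ ?_
    have hk := hmoment (k + 1)
    push_cast at hk
    have e1 : Real.exp (-γ * (((k : ℝ) + 1) ^ 2 + ((k : ℝ) + 1)) / 2) =
        Real.exp (-γ / 2) ^ (k + 1) * Real.exp (-γ / 2) ^ ((k + 1) ^ 2) := by
      rw [← Real.exp_nat_mul, ← Real.exp_nat_mul, ← Real.exp_add]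
      congr 1
      push_cast
      ring
    have e2 : Real.exp (-((k : ℝ) + 1) * γ) = Real.exp (-γ) ^ (k + 1) := by
      rw [← Real.exp_nat_mul]
      congr 1
      push_cast
      ring
    rw [hk, e1, e2, logThetaCoeff, hq]
    simp only [div_eq_mul_inv, mul_inv]
    ring
end
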